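/- Let α, β, δ, γ be linear maps on real sequences. If a map of one of the following four forms is bounded on Z₂, then it is strictly singular: S(ω,x) = (αω, δω) (depending only on the first coordinate), R(ω,x) = (βx, γx) (depending only on the second coordinate), T(ω,x) = (αω + βx, 0) (with range in the first coordinate), or M(ω,x) = (0, δω + γx) (with range in the second coordinate). -/

import Mathlib

open scoped BigOperators

noncomputable section

/-- Real sequences. -/
abbrev RSeq : Type := ℕ → ℝ

/-- Membership in ℓ². -/
def memL2 (x : RSeq) : Prop := Summable (fun n => (x n) ^ 2)

/-- The ℓ² norm. -/
noncomputable def l2norm (x : RSeq) : ℝ := Real.sqrt (∑' n, (x n) ^ 2)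

/-- The Kalton–Peck map, defined coordinatewise.  (In Lean, `Real.log 0 = 0` and
division by zero is zero, so the conventions `0·log 0 = 0` and `KP 0 = 0` hold.) -/
noncomputable def KP (x : RSeq) : RSeq := fun n => 2 * x n * Real.log (|x n| / l2norm x)

/-- Membership in the Kalton–Peck space Z₂. -/
def memZ2 (u : RSeq × RSeq) : Prop := memL2 u.2 ∧ memL2 (u.1 - KP u.2)

/-- The Z₂ quasinorm. -/
noncomputable def Z2norm (u : RSeq × RSeq) : ℝ := l2norm (u.1 - KP u.2) + l2norm u.2

/-- A map on pairs of sequences is bounded on Z₂. -/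
def BoundedOnZ2 (T : RSeq × RSeq → RSeq × RSeq) : Prop :=
  (∀ u, memZ2 u → memZ2 (T u)) ∧ ∃ C : ℝ, ∀ u, memZ2 u → Z2norm (T u) ≤ C * Z2norm u

/-- The matrix operator associated to four linear maps on sequences. -/
def matOp (α β δ γ : RSeq →ₗ[ℝ] RSeq) : RSeq × RSeq → RSeq × RSeq :=
  fun u => (α u.1 + β u.2, δ u.1 + γ u.2)

/-- Membership in the Orlicz space ℓ_f = Dom KP. -/
def memLf (x : RSeq) : Prop := memL2 x ∧ memL2 (KP x)

/-- The ℓ_f quasinorm. -/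
noncomputable def lfNorm (x : RSeq) : ℝ := l2norm (KP x) + l2norm x

/-- Membership in ℓ_f* = Ran KP. -/
def memLfStar (ω : RSeq) : Prop := ∃ x : RSeq, memL2 x ∧ memL2 (ω - KP x)

/-- The ℓ_f* quasinorm. -/
noncomputable def lfStarNorm (ω : RSeq) : ℝ :=
  sInf {r : ℝ | ∃ x : RSeq, memL2 x ∧ memL2 (ω - KP x) ∧ r = l2norm (ω - KP x) + l2norm x}

/-- A bounded map on Z₂ is strictly singular if every linear subspace of Z₂ on which it is
bounded below is finite dimensional. -/
def StrictlySingular (T : RSeq × RSeq → RSeq × RSeq) : Prop :=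
  ∀ V : Submodule ℝ (RSeq × RSeq), (∀ v ∈ V, memZ2 v) →
    (∃ c > 0, ∀ v ∈ V, c * Z2norm v ≤ Z2norm (T v)) → FiniteDimensional ℝ V

/-- A set of sequences is totally bounded (relatively compact) for the ℓ² norm. -/
def l2TotallyBounded (A : Set RSeq) : Prop :=
  ∀ ε > 0, ∃ S : Set RSeq, S.Finite ∧
    ∀ a ∈ A, ∃ s ∈ S, memL2 (a - s) ∧ l2norm (a - s) < ε

/-- A map on Z₂ is compact if the image of the unit ball is totally bounded for the
Z₂ quasinorm. -/
def CompactOnZ2 (T : RSeq × RSeq → RSeq × RSeq) : Prop :=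
  ∀ ε > 0, ∃ S : Set (RSeq × RSeq), S.Finite ∧
    ∀ u, memZ2 u → Z2norm u ≤ 1 → ∃ s ∈ S, memZ2 (T u - s) ∧ Z2norm (T u - s) < ε

/-! ### ℓ² basics -/

lemma l2norm_nonneg (x : RSeq) : 0 ≤ l2norm x := Real.sqrt_nonneg _

lemma l2norm_sq (x : RSeq) : (l2norm x) ^ 2 = ∑' n, (x n) ^ 2 :=
  Real.sq_sqrt (tsum_nonneg fun _ => sq_nonneg _)

lemma l2_of_fin {x : RSeq} {r : ℝ} (hr : 0 ≤ r)
    (h : ∀ m, ∑ n ∈ Finset.range m, (x n) ^ 2 ≤ r ^ 2) : memL2 x ∧ l2norm x ≤ r := by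
  have hs : Summable (fun n => (x n) ^ 2) :=
    summable_of_sum_range_le (fun _ => sq_nonneg _) h
  refine ⟨hs, ?_⟩
  apply Real.sqrt_le_iff.2 ⟨hr, ?_⟩
  exact hs.tsum_le_of_sum_range_le h

lemma fin_le {x : RSeq} (hx : memL2 x) (J : Finset ℕ) :
    ∑ n ∈ J, (x n) ^ 2 ≤ (l2norm x) ^ 2 := by
  rw [l2norm_sq]
  exact Summable.sum_le_tsum J (fun _ _ => sq_nonneg _) hx

lemma abs_le_l2 {x : RSeq} (hx : memL2 x) (n : ℕ) : |x n| ≤ l2norm x := by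
  have := fin_le hx {n}
  simp only [Finset.sum_singleton] at this
  exact abs_le_of_sq_le_sq this (l2norm_nonneg x)

lemma l2_cs {x y : RSeq} (hx : memL2 x) (hy : memL2 y) (J : Finset ℕ) :
    ∑ n ∈ J, |x n| * |y n| ≤ l2norm x * l2norm y := by
  have h1 := Finset.sum_mul_sq_le_sq_mul_sq J (fun n => |x n|) (fun n => |y n|)
  simp only [sq_abs] at h1
  have h2 := fin_le hx J
  have h3 := fin_le hy J
  have h4 : (∑ n ∈ J, |x n| * |y n|) ^ 2 ≤ (l2norm x * l2norm y) ^ 2 := by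
    rw [mul_pow]
    refine h1.trans ?_
    gcongr
  exact (abs_le.1 (abs_le_of_sq_le_sq h4 (mul_nonneg (l2norm_nonneg _) (l2norm_nonneg _)))).2

lemma l2_cs' {x y : RSeq} (hx : memL2 x) (hy : memL2 y) (J : Finset ℕ) :
    |∑ n ∈ J, x n * y n| ≤ l2norm x * l2norm y := by
  refine (Finset.abs_sum_le_sum_abs _ _).trans ?_
  simp only [abs_mul]
  exact l2_cs hx hy J

lemma l2_add {x y : RSeq} (hx : memL2 x) (hy : memL2 y) :
    memL2 (x + y) ∧ l2norm (x + y) ≤ l2norm x + l2norm y := by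
  apply l2_of_fin (add_nonneg (l2norm_nonneg _) (l2norm_nonneg _))
  intro m
  have h1 := fin_le hx (Finset.range m)
  have h2 := fin_le hy (Finset.range m)
  have h3 := (abs_le.1 (l2_cs' hx hy (Finset.range m))).2
  have : ∑ n ∈ Finset.range m, ((x + y) n) ^ 2 = ∑ n ∈ Finset.range m, (x n) ^ 2
      + 2 * ∑ n ∈ Finset.range m, x n * y n + ∑ n ∈ Finset.range m, (y n) ^ 2 := by
    rw [Finset.mul_sum, ← Finset.sum_add_distrib, ← Finset.sum_add_distrib]
    refine Finset.sum_congr rfl fun n _ => ?_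
    simp only [Pi.add_apply]; ring
  rw [this]
  nlinarith

lemma l2_mono {x y : RSeq} (hy : memL2 y) (h : ∀ n, |x n| ≤ |y n|) :
    memL2 x ∧ l2norm x ≤ l2norm y := by
  apply l2_of_fin (l2norm_nonneg _)
  intro m
  refine le_trans (Finset.sum_le_sum fun n _ => ?_) (fin_le hy (Finset.range m))
  exact sq_le_sq.2 (h n)

lemma memL2_smul {x : RSeq} (c : ℝ) (hx : memL2 x) : memL2 (c • x) := by
  have : Summable (fun n => c ^ 2 * (x n) ^ 2) := Summable.mul_left _ hx
  unfold memL2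
  simpa [mul_pow] using this

lemma l2norm_smul (c : ℝ) (x : RSeq) : l2norm (c • x) = |c| * l2norm x := by
  unfold l2norm
  simp only [Pi.smul_apply, smul_eq_mul, mul_pow]
  rw [tsum_mul_left, Real.sqrt_mul (sq_nonneg _), Real.sqrt_sq_eq_abs]

lemma l2norm_zero : l2norm 0 = 0 := by simp [l2norm]

lemma memL2_zero : memL2 0 := by unfold memL2; simp

lemma l2norm_neg (x : RSeq) : l2norm (-x) = l2norm x := by simp [l2norm]

lemma memL2_neg {x : RSeq} (hx : memL2 x) : memL2 (-x) := by
  unfold memL2 at *; simpa using hx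

lemma l2_sub {x y : RSeq} (hx : memL2 x) (hy : memL2 y) :
    memL2 (x - y) ∧ l2norm (x - y) ≤ l2norm x + l2norm y := by
  have := l2_add hx (memL2_neg hy)
  rw [l2norm_neg, ← sub_eq_add_neg] at this
  exact this

lemma eq_zero_of_l2 {x : RSeq} (hx : memL2 x) (h : l2norm x = 0) : x = 0 := by
  funext n
  have := abs_le_l2 hx n
  rw [h] at this
  simpa using abs_nonpos_iff.1 this

/-- Finitely supported. -/
def FS (x : RSeq) : Prop := ∃ m, ∀ n, m ≤ n → x n = 0

lemma FS.memL2 {x : RSeq} (h : FS x) : memL2 x := by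
  obtain ⟨m, hm⟩ := h
  apply summable_of_ne_finset_zero (s := Finset.range m)
  intro n hn
  rw [hm n (by simpa using hn)]; simp

lemma FS.mono {x y : RSeq} (h : FS x) (hxy : ∀ n, x n = 0 → y n = 0) : FS y := by
  obtain ⟨m, hm⟩ := h
  exact ⟨m, fun n hn => hxy n (hm n hn)⟩

lemma FS.add {x y : RSeq} (hx : FS x) (hy : FS y) : FS (x + y) := by
  obtain ⟨m, hm⟩ := hx
  obtain ⟨k, hk⟩ := hy
  refine ⟨max m k, fun n hn => ?_⟩
  simp [hm n (le_trans (le_max_left _ _) hn), hk n (le_trans (le_max_right _ _) hn)]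

lemma FS.smul {x : RSeq} (c : ℝ) (hx : FS x) : FS (c • x) :=
  hx.mono fun n h => by simp [h]

lemma FS.zero : FS 0 := ⟨0, fun _ _ => rfl⟩

lemma FS.neg {x : RSeq} (hx : FS x) : FS (-x) := hx.mono fun n h => by simp [h]

lemma FS.sub {x y : RSeq} (hx : FS x) (hy : FS y) : FS (x - y) := by
  rw [sub_eq_add_neg]; exact hx.add hy.neg

lemma FS.KP {x : RSeq} (hx : FS x) : FS (KP x) := hx.mono fun n h => by simp [_root_.KP, h]

lemma FS.sum {N : ℕ} {y : ℕ → RSeq} (h : ∀ k, FS (y k)) : FS (∑ k ∈ Finset.range N, y k) := by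
  induction N with
  | zero => simpa using FS.zero
  | succ N ih => rw [Finset.sum_range_succ]; exact ih.add (h N)

/-- head and tail of a sequence -/
def hd (m : ℕ) (x : RSeq) : RSeq := fun n => if n < m then x n else 0
def tl (m : ℕ) (x : RSeq) : RSeq := fun n => if n < m then 0 else x n

lemma hd_add_tl (m : ℕ) (x : RSeq) : hd m x + tl m x = x := by
  funext n; simp only [Pi.add_apply, hd, tl]; split_ifs <;> simp

lemma hd_FS (m : ℕ) (x : RSeq) : FS (hd m x) :=
  ⟨m, fun n hn => by simp [hd, not_lt.2 hn]⟩

lemma tl_l2 {x : RSeq} (hx : memL2 x) (m : ℕ) : memL2 (tl m x) ∧ l2norm (tl m x) ≤ l2norm x :=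
  l2_mono hx fun n => by simp only [tl]; split_ifs <;> simp

lemma hd_l2 {x : RSeq} (hx : memL2 x) (m : ℕ) : memL2 (hd m x) ∧ l2norm (hd m x) ≤ l2norm x :=
  l2_mono hx fun n => by simp only [hd]; split_ifs <;> simp

lemma tl_small {x : RSeq} (hx : memL2 x) {ε : ℝ} (hε : 0 < ε) :
    ∃ m0, ∀ m, m0 ≤ m → l2norm (tl m x) ≤ ε := by
  have h1 := (Summable.hasSum hx).tendsto_sum_nat
  have h2 := h1.eventually (lt_mem_nhds (show (∑' n, (x n) ^ 2) - ε ^ 2 < ∑' n, (x n) ^ 2 by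
    have := pow_pos hε 2; linarith))
  obtain ⟨m0, hm0⟩ := Filter.eventually_atTop.1 h2
  refine ⟨m0, fun m hm => (l2_of_fin hε.le fun M => ?_).2⟩
  have h3 := hm0 m hm
  have h4 := fin_le hx (Finset.range (m + M))
  rw [l2norm_sq] at h4
  rw [Finset.sum_range_add] at h4
  have h5 : ∑ n ∈ Finset.range M, (tl m x n) ^ 2 ≤ ∑ n ∈ Finset.range (m + M), (tl m x n) ^ 2 :=
    Finset.sum_le_sum_of_subset_of_nonneg (Finset.range_mono (by omega))
      fun _ _ _ => sq_nonneg _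
  rw [Finset.sum_range_add] at h5
  have h6 : ∑ n ∈ Finset.range m, (tl m x n) ^ 2 = 0 := by
    apply Finset.sum_eq_zero; intro n hn; simp [tl, Finset.mem_range.1 hn]
  have h7 : ∑ n ∈ Finset.range M, (tl m x (m + n)) ^ 2 = ∑ n ∈ Finset.range M, (x (m + n)) ^ 2 := by
    simp [tl]
  rw [h6, h7] at h5
  linarith

/-! ### The Kalton–Peck map and the quasinorm -/

lemma aux_log {t m : ℝ} (h : |t| ≤ m) : |t * Real.log (|t| / m)| ≤ m := by
  rcases eq_or_ne t 0 with rfl | ht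
  · simpa using h
  have ht' : 0 < |t| := abs_pos.2 ht
  have hm : 0 < m := ht'.trans_le h
  have := (Real.abs_log_mul_self_lt (|t| / m) (by positivity) ((div_le_one hm).2 h)).le
  rw [abs_mul, abs_div, abs_abs, abs_of_pos hm] at this
  rw [abs_mul]
  calc |t| * |Real.log (|t| / m)| = m * (|Real.log (|t| / m)| * (|t| / m)) := by field_simp
    _ ≤ m * 1 := by gcongr
    _ = m := mul_one m

lemma aux_log' {t m : ℝ} (h0 : 0 < t) (h : t ≤ m) : |Real.log m - Real.log t| * t ≤ m := by
  have := aux_log (t := t) (m := m) (by rwa [abs_of_pos h0])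
  rw [abs_of_pos h0, Real.log_div h0.ne' (h0.trans_le h).ne', abs_mul, abs_of_pos h0,
    abs_sub_comm] at this
  linarith

lemma KP_eq {x : RSeq} (hx : l2norm x ≠ 0) (n : ℕ) :
    KP x n = 2 * (x n * Real.log (x n)) - 2 * (x n * Real.log (l2norm x)) := by
  unfold KP
  rcases eq_or_ne (x n) 0 with h | h
  · simp [h]
  · rw [Real.log_div (abs_pos.2 h).ne' hx, Real.log_abs]; ring

lemma theta_le (a b : ℝ) : |(a + b) * Real.log (a + b) - a * Real.log a - b * Real.log b|
    ≤ 3 * (|a| + |b|) := by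
  set m := |a| + |b| with hm
  have hm0 : 0 ≤ m := by positivity
  rcases hm0.eq_or_lt with h | h
  · have h1 : |a| = 0 := by have := abs_nonneg a; have := abs_nonneg b; linarith
    have h2 : |b| = 0 := by have := abs_nonneg a; have := abs_nonneg b; linarith
    rw [abs_eq_zero] at h1 h2
    simp [h1, h2, hm0]
  have key : ∀ t : ℝ, t * Real.log (|t| / m) = t * Real.log t - t * Real.log m := by
    intro t
    rcases eq_or_ne t 0 with rfl | ht
    · simp
    · rw [Real.log_div (abs_pos.2 ht).ne' h.ne', Real.log_abs]; ring
  have h1 := aux_log (t := a) (m := m) (by have := abs_nonneg b; linarith)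
  have h2 := aux_log (t := b) (m := m) (by have := abs_nonneg a; linarith)
  have h3 := aux_log (t := a + b) (m := m) (abs_add_le a b)
  rw [key] at h1 h2 h3
  rw [abs_le] at *
  constructor <;> linarith [h1.1, h1.2, h2.1, h2.2, h3.1, h3.2]

lemma KP_zero : KP 0 = 0 := by funext n; simp [KP]

lemma KP_smul (c : ℝ) (x : RSeq) : KP (c • x) = c • KP x := by
  rcases eq_or_ne c 0 with rfl | hc
  · simp [KP_zero]
  funext n
  simp only [KP, l2norm_smul, Pi.smul_apply, smul_eq_mul, abs_mul]
  rw [mul_div_mul_left _ _ (abs_pos.2 hc).ne']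
  ring

lemma l2_abs {x : RSeq} (hx : memL2 x) :
    memL2 (fun n => |x n|) ∧ l2norm (fun n => |x n|) ≤ l2norm x :=
  l2_mono hx fun n => by simp

lemma KP_quasi {x y : RSeq} (hx : memL2 x) (hy : memL2 y) :
    memL2 (KP (x + y) - KP x - KP y) ∧
      l2norm (KP (x + y) - KP x - KP y) ≤ 12 * (l2norm x + l2norm y) := by
  have triv : KP (x + y) - KP x - KP y = 0 → memL2 (KP (x + y) - KP x - KP y) ∧
      l2norm (KP (x + y) - KP x - KP y) ≤ 12 * (l2norm x + l2norm y) := by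
    intro h
    rw [h, l2norm_zero]
    have := l2norm_nonneg x
    have := l2norm_nonneg y
    exact ⟨memL2_zero, by linarith⟩
  obtain ⟨hxy, htri⟩ := l2_add hx hy
  rcases (l2norm_nonneg x).eq_or_lt with h | hr
  · apply triv; rw [eq_zero_of_l2 hx h.symm]; simp [KP_zero]
  rcases (l2norm_nonneg y).eq_or_lt with h | hs
  · apply triv; rw [eq_zero_of_l2 hy h.symm]; simp [KP_zero]
  rcases (l2norm_nonneg (x + y)).eq_or_lt with h | hq
  · apply triv
    have h0 := eq_zero_of_l2 hxy h.symm
    have h1 : y = (-1 : ℝ) • x := by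
      rw [neg_one_smul]; exact (neg_eq_of_add_eq_zero_right h0).symm
    rw [h0, h1, KP_smul, KP_zero]; simp
  set h := l2norm x + l2norm y with hh
  set E : RSeq := fun n => 2 * ((x n + y n) * Real.log (x n + y n) - x n * Real.log (x n)
    - y n * Real.log (y n)) with hE
  have hD : KP (x + y) - KP x - KP y = (E + (2 * (Real.log h - Real.log (l2norm (x + y)))) • (x + y))
      - ((2 * (Real.log h - Real.log (l2norm x))) • x
      + (2 * (Real.log h - Real.log (l2norm y))) • y) := by
    funext n
    simp only [Pi.sub_apply, Pi.add_apply, Pi.smul_apply, smul_eq_mul]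
    rw [KP_eq hr.ne', KP_eq hs.ne', KP_eq hq.ne', hE]
    simp only [Pi.add_apply]
    ring
  have hE1 : memL2 E ∧ l2norm E ≤ 6 * h := by
    obtain ⟨a1, a2⟩ := l2_abs hx
    obtain ⟨b1, b2⟩ := l2_abs hy
    obtain ⟨c1, c2⟩ := l2_add a1 b1
    have d := l2_mono (x := E) (memL2_smul 6 c1) fun n => by
      have := theta_le (x n) (y n)
      have h3 : (0:ℝ) ≤ |x n| + |y n| := by positivity
      simp only [hE, Pi.smul_apply, smul_eq_mul, Pi.add_apply, abs_mul, abs_of_nonneg h3]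
      norm_num
      linarith
    rw [l2norm_smul] at d
    refine ⟨d.1, d.2.trans ?_⟩
    norm_num
    linarith
  have i1 := aux_log' hr (show l2norm x ≤ h by linarith)
  have i2 := aux_log' hs (show l2norm y ≤ h by linarith)
  have i3 := aux_log' hq htri
  have j1 := memL2_smul (2 * (Real.log h - Real.log (l2norm x))) hx
  have j2 := memL2_smul (2 * (Real.log h - Real.log (l2norm y))) hy
  have j3 := memL2_smul (2 * (Real.log h - Real.log (l2norm (x + y)))) hxy
  have k1 := l2_add hE1.1 j3
  have k2 := l2_add j1 j2
  have k3 := l2_sub k1.1 k2.1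
  rw [hD]
  refine ⟨k3.1, k3.2.trans ?_⟩
  have k12 := k1.2
  have k22 := k2.2
  rw [l2norm_smul, abs_mul, abs_two] at k12
  rw [l2norm_smul, l2norm_smul, abs_mul, abs_mul, abs_two] at k22
  linarith [hE1.2]

lemma Z2norm_nonneg (u : RSeq × RSeq) : 0 ≤ Z2norm u :=
  add_nonneg (l2norm_nonneg _) (l2norm_nonneg _)

lemma Z2_add {u v : RSeq × RSeq} (hu : memZ2 u) (hv : memZ2 v) :
    memZ2 (u + v) ∧ Z2norm (u + v) ≤ 13 * (Z2norm u + Z2norm v) := by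
  obtain ⟨h1, h2⟩ := l2_add hu.1 hv.1
  obtain ⟨h3, h4⟩ := l2_add hu.2 hv.2
  obtain ⟨h5, h6⟩ := KP_quasi hu.1 hv.1
  obtain ⟨h7, h8⟩ := l2_sub h3 h5
  have e : (u + v).1 - KP (u + v).2 =
      u.1 - KP u.2 + (v.1 - KP v.2) - (KP (u.2 + v.2) - KP u.2 - KP v.2) := by
    simp only [Prod.fst_add, Prod.snd_add]; abel
  refine ⟨⟨h1, by rw [e]; exact h7⟩, ?_⟩
  unfold Z2norm
  rw [e, Prod.snd_add]
  have := l2norm_nonneg (u.1 - KP u.2)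
  have := l2norm_nonneg (v.1 - KP v.2)
  linarith

lemma Z2_smul {u : RSeq × RSeq} (c : ℝ) (hu : memZ2 u) : memZ2 (c • u) := by
  refine ⟨memL2_smul c hu.1, ?_⟩
  have : (c • u).1 - KP (c • u).2 = c • (u.1 - KP u.2) := by
    simp [KP_smul, smul_sub]
  rw [this]
  exact memL2_smul c hu.2

lemma Z2norm_smul (c : ℝ) (u : RSeq × RSeq) : Z2norm (c • u) = |c| * Z2norm u := by
  have : (c • u).1 - KP (c • u).2 = c • (u.1 - KP u.2) := by
    simp [KP_smul, smul_sub]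
  unfold Z2norm
  rw [this, Prod.smul_snd, l2norm_smul, l2norm_smul]; ring

lemma Z2_zero : memZ2 0 ∧ Z2norm 0 = 0 := by
  simp [memZ2, Z2norm, KP_zero, l2norm_zero, memL2_zero]

lemma Z2_pos {u : RSeq × RSeq} (hu : memZ2 u) (h : u ≠ 0) : 0 < Z2norm u := by
  refine lt_of_le_of_ne (Z2norm_nonneg u) fun h0 => h ?_
  have a := l2norm_nonneg (u.1 - KP u.2)
  have b := l2norm_nonneg u.2
  unfold Z2norm at h0
  have h2 := eq_zero_of_l2 hu.1 (by linarith)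
  have h1 := eq_zero_of_l2 hu.2 (by linarith)
  rw [h2, KP_zero, sub_zero] at h1
  exact Prod.ext h1 h2

lemma Z2_sub {u v : RSeq × RSeq} (hu : memZ2 u) (hv : memZ2 v) :
    memZ2 (u - v) ∧ Z2norm (u - v) ≤ 13 * (Z2norm u + Z2norm v) := by
  have h := Z2_add hu (Z2_smul (-1) hv)
  rw [Z2norm_smul] at h
  simpa [sub_eq_add_neg] using h

lemma Z2_inl {y : RSeq} (hy : memL2 y) : memZ2 (y, 0) := by
  refine ⟨memL2_zero, ?_⟩
  simpa [KP_zero] using hy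

lemma Z2norm_inl (y : RSeq) : Z2norm (y, 0) = l2norm y := by
  simp [Z2norm, KP_zero, l2norm_zero]

lemma Z2_KP {x : RSeq} (hx : memL2 x) : memZ2 (KP x, x) := by
  refine ⟨hx, ?_⟩
  simpa using memL2_zero

lemma Z2norm_KP (x : RSeq) : Z2norm (KP x, x) = l2norm x := by
  simp [Z2norm, l2norm_zero]

lemma Z2_FS {u : RSeq × RSeq} (h1 : FS u.1) (h2 : FS u.2) : memZ2 u :=
  ⟨h2.memL2, (h1.sub h2.KP).memL2⟩

lemma Z2_sum {u : ℕ → RSeq × RSeq} (hu : ∀ k, memZ2 (u k)) (N : ℕ) :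
    memZ2 (∑ k ∈ Finset.range N, u k) := by
  induction N with
  | zero => simpa using Z2_zero.1
  | succ N ih => rw [Finset.sum_range_succ]; exact (Z2_add ih (hu N)).1

lemma Z2norm_sum {u : ℕ → RSeq × RSeq} (hu : ∀ k, memZ2 (u k)) (N : ℕ) :
    Z2norm (∑ k ∈ Finset.range N, u k) ≤ ∑ k ∈ Finset.range N, 13 ^ (k + 1) * Z2norm (u k) := by
  induction N generalizing u with
  | zero => simp [Z2_zero.2]
  | succ N ih =>
    rw [Finset.sum_range_succ', Finset.sum_range_succ']
    have h := Z2_add (Z2_sum (fun k => hu (k + 1)) N) (hu 0)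
    refine h.2.trans ?_
    have h2 := ih (fun k => hu (k + 1))
    have h3 : ∑ k ∈ Finset.range N, 13 ^ (k + 1 + 1) * Z2norm (u (k + 1))
        = 13 * ∑ k ∈ Finset.range N, 13 ^ (k + 1) * Z2norm (u (k + 1)) := by
      rw [Finset.mul_sum]; refine Finset.sum_congr rfl fun k _ => by ring
    rw [h3]
    simp only [zero_add, pow_one]
    linarith

/-- geometrically small errors -/
lemma Z2_err {u : ℕ → RSeq × RSeq} (hu : ∀ k, memZ2 (u k))
    (hs : ∀ k, Z2norm (u k) ≤ (1 / 26) ^ (k + 1)) {φ : ℕ → ℕ} (hφ : StrictMono φ)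
    {a : ℕ → ℝ} {A : ℝ} (ha : ∀ k, |a k| ≤ A) (N : ℕ) :
    memZ2 (∑ k ∈ Finset.range N, a k • u (φ k)) ∧
    Z2norm (∑ k ∈ Finset.range N, a k • u (φ k)) ≤ A := by
  have hA : 0 ≤ A := (abs_nonneg _).trans (ha 0)
  have h0 : ∀ k, memZ2 (a k • u (φ k)) := fun k => Z2_smul _ (hu _)
  refine ⟨Z2_sum h0 N, (Z2norm_sum h0 N).trans ?_⟩
  have h1 : ∀ k ∈ Finset.range N, 13 ^ (k + 1) * Z2norm (a k • u (φ k)) ≤ A * (1 / 2) * (1 / 2) ^ k := by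
    intro k _
    rw [Z2norm_smul]
    have h2 : Z2norm (u (φ k)) ≤ (1 / 26) ^ (k + 1) :=
      (hs _).trans (pow_le_pow_of_le_one (by norm_num) (by norm_num) (by
        have := hφ.le_apply (x := k); omega))
    calc (13:ℝ) ^ (k + 1) * (|a k| * Z2norm (u (φ k))) ≤ 13 ^ (k + 1) * (A * (1 / 26) ^ (k + 1)) := by
          have := Z2norm_nonneg (u (φ k))
          gcongr
          exact ha k
      _ = A * (13 * (1 / 26)) ^ (k + 1) := by rw [mul_pow]; ring
      _ = _ := by norm_num [pow_succ]; ring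
  refine (Finset.sum_le_sum h1).trans ?_
  rw [← Finset.mul_sum]
  have h3 : ∑ k ∈ Finset.range N, ((1:ℝ) / 2) ^ k ≤ 2 := by
    have := Summable.sum_le_tsum (Finset.range N) (fun k _ => by positivity)
      summable_geometric_two
    rwa [tsum_geometric_two] at this
  nlinarith

/-! ### Tails and disjoint sequences -/

def tlp (m : ℕ) (v : RSeq × RSeq) : RSeq × RSeq := (tl m v.1, tl m v.2)
def hdp (m : ℕ) (v : RSeq × RSeq) : RSeq × RSeq := (hd m v.1, hd m v.2)

lemma hdp_add_tlp (m : ℕ) (v : RSeq × RSeq) : hdp m v + tlp m v = v :=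
  Prod.ext (hd_add_tl m v.1) (hd_add_tl m v.2)

lemma aux_log2 {t m : ℝ} (h0 : 0 < t) (h : t ≤ m) :
    |Real.log m - Real.log t| * t ≤ 2 * Real.sqrt m * Real.sqrt t := by
  have h1 := aux_log' (Real.sqrt_pos.2 h0) (Real.sqrt_le_sqrt h)
  rw [Real.log_sqrt h0.le, Real.log_sqrt (h0.le.trans h), ← sub_div, abs_div, abs_two] at h1
  have h2 : Real.sqrt t * Real.sqrt t = t := Real.mul_self_sqrt h0.le
  have h3 := mul_le_mul_of_nonneg_right h1 (Real.sqrt_nonneg t)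
  rw [mul_assoc, h2] at h3
  linarith

lemma Z2_tail {v : RSeq × RSeq} (hv : memZ2 v) {ε : ℝ} (hε : 0 < ε) :
    ∃ m0, ∀ m, m0 ≤ m → memZ2 (tlp m v) ∧ Z2norm (tlp m v) ≤ ε := by
  obtain ⟨hx, hb⟩ := hv
  set r := l2norm v.2 with hr
  set τ := min 1 (ε / (3 + 4 * Real.sqrt r)) with hτ
  have hsr := Real.sqrt_nonneg r
  have hτ0 : 0 < τ := lt_min one_pos (by positivity)
  have hτ1 : τ ≤ 1 := min_le_left _ _
  have hτ2 : τ * (3 + 4 * Real.sqrt r) ≤ ε := by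
    have := min_le_right 1 (ε / (3 + 4 * Real.sqrt r))
    rwa [le_div_iff₀ (by positivity)] at this
  have hτ3 : 0 < τ ^ 2 := by positivity
  obtain ⟨m1, h1⟩ := tl_small hx hτ3
  obtain ⟨m2, h2⟩ := tl_small hb hτ3
  refine ⟨max m1 m2, fun m hm => ?_⟩
  have i1 := h1 m (le_trans (le_max_left _ _) hm)
  have i2 := h2 m (le_trans (le_max_right _ _) hm)
  obtain ⟨hx1, hx2⟩ := tl_l2 hx m
  obtain ⟨hb1, hb2⟩ := tl_l2 hb m
  set ρ := l2norm (tl m v.2) with hρ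
  have e : (tlp m v).1 - KP (tlp m v).2 =
      tl m (v.1 - KP v.2) + (2 * (Real.log ρ - Real.log r)) • tl m v.2 := by
    rcases (l2norm_nonneg (tl m v.2)).eq_or_lt with h0 | h0
    · have hz := eq_zero_of_l2 hx1 h0.symm
      simp only [tlp, hz, KP_zero, smul_zero, add_zero, sub_zero]
      funext n
      have hzn := congrFun hz n
      simp only [tl, Pi.zero_apply] at hzn ⊢
      split_ifs with hn
      · rfl
      · rw [if_neg hn] at hzn
        simp [KP, hzn]
    · have hr0 : r ≠ 0 := (h0.trans_le hx2).ne'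
      funext n
      simp only [tlp, Pi.sub_apply, Pi.add_apply, Pi.smul_apply, smul_eq_mul]
      rw [KP_eq h0.ne', ← hρ]
      simp only [tl]
      split_ifs with hn
      · simp
      · rw [Pi.sub_apply, KP_eq hr0]; ring
  have hs := l2_add hb1 (memL2_smul (2 * (Real.log ρ - Real.log r)) hx1)
  refine ⟨⟨hx1, by rw [e]; exact hs.1⟩, ?_⟩
  unfold Z2norm
  rw [e]
  have hs2 := hs.2
  rw [l2norm_smul, abs_mul, abs_two, abs_sub_comm] at hs2
  have h3 : |Real.log r - Real.log ρ| * ρ ≤ 2 * Real.sqrt r * τ := by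
    rcases (l2norm_nonneg (tl m v.2)).eq_or_lt with h0 | h0
    · rw [hρ, ← h0]; simp; positivity
    · refine (aux_log2 h0 hx2).trans ?_
      gcongr
      exact Real.sqrt_le_iff.2 ⟨hτ0.le, i1⟩
  show l2norm _ + ρ ≤ ε
  have h4 : τ ^ 2 ≤ τ := by nlinarith
  nlinarith

def DJ (y : ℕ → RSeq) : Prop := ∀ j k n, j ≠ k → y j n = 0 ∨ y k n = 0

lemma DJ.point {y : ℕ → RSeq} (h : DJ y) (n : ℕ) : ∃ k0, ∀ k, k ≠ k0 → y k n = 0 := by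
  by_cases hh : ∃ k, y k n ≠ 0
  · obtain ⟨k0, hk0⟩ := hh
    exact ⟨k0, fun k hk => (h k k0 n hk).resolve_right hk0⟩
  · push Not at hh
    exact ⟨0, fun k _ => hh k⟩

lemma DJ.comp {y : ℕ → RSeq} (h : DJ y) {φ : ℕ → ℕ} (hφ : StrictMono φ) : DJ (y ∘ φ) :=
  fun _ _ n hjk => h _ _ n (hφ.injective.ne hjk)

lemma sum_point {y : ℕ → RSeq} {n k0 : ℕ} (h : ∀ k, k ≠ k0 → y k n = 0) (a : ℕ → ℝ) (N : ℕ) :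
    (∑ k ∈ Finset.range N, a k • y k) n = if k0 < N then a k0 * y k0 n else 0 := by
  rw [Finset.sum_apply]
  simp only [Pi.smul_apply, smul_eq_mul]
  split_ifs with hk
  · rw [Finset.sum_eq_single k0]
    · intro k _ hk; rw [h k hk, mul_zero]
    · intro hh; simp at hh; omega
  · apply Finset.sum_eq_zero
    intro k hkN
    rw [h k (by rintro rfl; simp at hkN; omega), mul_zero]

lemma DJ.norm {y : ℕ → RSeq} (h : DJ y) (hy : ∀ k, memL2 (y k)) (a : ℕ → ℝ) (N : ℕ) :
    l2norm (∑ k ∈ Finset.range N, a k • y k) ^ 2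
      = ∑ k ∈ Finset.range N, (a k) ^ 2 * l2norm (y k) ^ 2 := by
  have e : ∀ n, ((∑ k ∈ Finset.range N, a k • y k) n) ^ 2
      = ∑ k ∈ Finset.range N, (a k) ^ 2 * (y k n) ^ 2 := by
    intro n
    obtain ⟨k0, hk0⟩ := h.point n
    rw [sum_point hk0]
    have := sum_point (y := fun k m => (y k m) ^ 2) (n := n) (k0 := k0)
      (fun k hk => by simp [hk0 k hk]) (fun k => (a k) ^ 2) N
    rw [Finset.sum_apply] at this
    simp only [Pi.smul_apply, smul_eq_mul] at this
    rw [this]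
    split_ifs <;> ring
  rw [l2norm_sq]
  simp only [e, l2norm_sq]
  rw [Summable.tsum_finsetSum]
  · simp only [tsum_mul_left]
  · intro k _
    exact Summable.mul_left _ (hy k)

/-- normalized disjoint finitely supported sequences -/
structure NB (y : ℕ → RSeq) : Prop where
  fs : ∀ k, FS (y k)
  dj : DJ y
  nm : ∀ k, l2norm (y k) = 1

lemma NB.comp {y : ℕ → RSeq} (h : NB y) {φ : ℕ → ℕ} (hφ : StrictMono φ) : NB (y ∘ φ) :=
  ⟨fun _ => h.fs _, h.dj.comp hφ, fun _ => h.nm _⟩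

def comb (N : ℕ) (s : ℕ → ℝ) (y : ℕ → RSeq) : RSeq :=
  ∑ k ∈ Finset.range N, (s k / Real.sqrt N) • y k

def IsSign (s : ℕ → ℝ) : Prop := ∀ k, |s k| = 1

lemma IsSign.abs_div {s : ℕ → ℝ} (hs : IsSign s) (N k : ℕ) :
    |s k / Real.sqrt N| = 1 / Real.sqrt N := by
  rw [_root_.abs_div, hs k, abs_of_nonneg (Real.sqrt_nonneg _)]

lemma IsSign.sq_div {s : ℕ → ℝ} (hs : IsSign s) (N k : ℕ) :
    (s k / Real.sqrt N) ^ 2 = 1 / N := by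
  rw [← sq_abs, hs.abs_div, div_pow, one_pow, Real.sq_sqrt (Nat.cast_nonneg N)]

lemma comb_FS {y : ℕ → RSeq} (h : ∀ k, FS (y k)) (N : ℕ) (s : ℕ → ℝ) : FS (comb N s y) :=
  FS.sum fun k => (h k).smul _

lemma comb_norm_le {y : ℕ → RSeq} (h : DJ y) (hy : ∀ k, memL2 (y k)) {B : ℝ} (hB : 0 ≤ B)
    (hn : ∀ k, l2norm (y k) ≤ B) {N : ℕ} {s : ℕ → ℝ} (hs : IsSign s) :
    l2norm (comb N s y) ≤ B := by
  rcases Nat.eq_zero_or_pos N with rfl | hN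
  · simpa [comb, l2norm_zero] using hB
  apply abs_le_of_sq_le_sq' _ hB |>.2
  rw [comb, h.norm hy]
  simp only [hs.sq_div]
  calc ∑ k ∈ Finset.range N, 1 / (N:ℝ) * l2norm (y k) ^ 2
      ≤ ∑ k ∈ Finset.range N, 1 / (N:ℝ) * B ^ 2 := by
        gcongr with k
        · exact l2norm_nonneg _
        · exact hn k
    _ = B ^ 2 := by
        rw [Finset.sum_const, Finset.card_range, nsmul_eq_mul]; field_simp

lemma comb_norm_ge {y : ℕ → RSeq} (h : DJ y) (hy : ∀ k, memL2 (y k)) {B : ℝ} (hB : 0 ≤ B)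
    (hn : ∀ k, B ≤ l2norm (y k)) {N : ℕ} (hN : 0 < N) {s : ℕ → ℝ} (hs : IsSign s) :
    B ≤ l2norm (comb N s y) := by
  apply abs_le_of_sq_le_sq' _ (l2norm_nonneg _) |>.2
  rw [comb, h.norm hy]
  simp only [hs.sq_div]
  calc B ^ 2 = ∑ k ∈ Finset.range N, 1 / (N:ℝ) * B ^ 2 := by
        rw [Finset.sum_const, Finset.card_range, nsmul_eq_mul]; field_simp
    _ ≤ _ := by
        gcongr with k
        exact hn k

lemma NB.comb_norm {y : ℕ → RSeq} (h : NB y) {N : ℕ} (hN : 0 < N) {s : ℕ → ℝ} (hs : IsSign s) :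
    l2norm (comb N s y) = 1 :=
  le_antisymm (comb_norm_le h.dj (fun k => (h.fs k).memL2) zero_le_one (fun k => (h.nm k).le) hs)
    (comb_norm_ge h.dj (fun k => (h.fs k).memL2) zero_le_one (fun k => (h.nm k).ge) hN hs)

lemma NB.comb_sup {y : ℕ → RSeq} (h : NB y) {N : ℕ} {s : ℕ → ℝ} (hs : IsSign s)
    (n : ℕ) : |comb N s y n| ≤ 1 / Real.sqrt N := by
  obtain ⟨k0, hk0⟩ := h.dj.point n
  rw [comb, sum_point hk0]
  split_ifs with hk
  · rw [abs_mul, hs.abs_div]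
    have := abs_le_l2 (h.fs k0).memL2 n
    rw [h.nm] at this
    exact mul_le_of_le_one_right (by positivity) this
  · simp

lemma NB.comb_KP {y : ℕ → RSeq} (h : NB y) {N : ℕ} (hN : 0 < N) {s : ℕ → ℝ} (hs : IsSign s) :
    KP (comb N s y) = comb N s (fun k => KP (y k)) - Real.log N • comb N s y := by
  funext n
  obtain ⟨k0, hk0⟩ := h.dj.point n
  have hN' : (0:ℝ) < N := by exact_mod_cast hN
  have h1 := h.comb_norm hN hs
  rw [KP_eq (by rw [h1]; norm_num), h1, Pi.sub_apply, Pi.smul_apply]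
  rw [comb, comb, sum_point hk0, sum_point (y := fun k => KP (y k)) (k0 := k0)
    (fun k hk => by simp [KP, hk0 k hk])]
  split_ifs with hk
  · rw [KP_eq (by rw [h.nm]; norm_num), h.nm]
    rcases eq_or_ne (y k0 n) 0 with hz | hz
    · simp [hz]
    have hs0 : s k0 / Real.sqrt N ≠ 0 := by
      rw [← abs_pos, hs.abs_div]; positivity
    have hl : Real.log (s k0 / Real.sqrt N) = - (Real.log N / 2) := by
      rw [← Real.log_abs, hs.abs_div, one_div, Real.log_inv, Real.log_sqrt hN'.le]
    rw [Real.log_mul hs0 hz, hl]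
    simp only [Real.log_one, smul_eq_mul]
    ring
  · simp

/-! ### The general criterion -/

abbrev LinP := (RSeq × RSeq) →ₗ[ℝ] (RSeq × RSeq)

/-- hypothesis of the criterion -/
def HH (T : LinP) : Prop := ∀ y, NB y → ∀ ε > 0, ∀ N0 : ℕ, ∃ φ : ℕ → ℕ, StrictMono φ ∧
  ∃ N, N0 ≤ N ∧ ∃ s, IsSign s ∧ Z2norm (T (comb N s (y ∘ φ), 0)) ≤ ε

/-- lower estimate -/
def LowE (T : LinP) (c C : ℝ) (v : ℕ → RSeq × RSeq) : Prop :=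
  ∀ φ : ℕ → ℕ, StrictMono φ → ∀ (N : ℕ) (A : ℝ) (a : ℕ → ℝ), (∀ k, |a k| ≤ A) →
    c * Z2norm (∑ k ∈ Finset.range N, a k • v (φ k))
      ≤ Z2norm (T (∑ k ∈ Finset.range N, a k • v (φ k))) + C * A

lemma LowE.comp {T : LinP} {c C : ℝ} {v : ℕ → RSeq × RSeq} (h : LowE T c C v) {ψ : ℕ → ℕ}
    (hψ : StrictMono ψ) : LowE T c C (v ∘ ψ) :=
  fun φ hφ N A a ha => h (ψ ∘ φ) (hψ.comp hφ) N A a ha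

lemma LowE.scale {T : LinP} {c C : ℝ} {v : ℕ → RSeq × RSeq} (h : LowE T c C v) {t : ℕ → ℝ} {τ : ℝ}
    (ht : ∀ k, |t k| ≤ τ) : LowE T c (C * τ) (fun k => t k • v k) := by
  intro φ hφ N A a ha
  have := h φ hφ N (A * τ) (fun k => a k * t (φ k)) (fun k => by
    rw [abs_mul]
    exact mul_le_mul (ha k) (ht _) (abs_nonneg _) ((abs_nonneg _).trans (ha k)))
  simp only [mul_smul] at this
  linarith

lemma LowE.perturb {T : LinP} {B : ℝ} (hB0 : 0 ≤ B) (hTm : ∀ u, memZ2 u → memZ2 (T u))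
    (hB : ∀ u, memZ2 u → Z2norm (T u) ≤ B * Z2norm u)
    {c C : ℝ} (hc : 0 < c) {v v' e : ℕ → RSeq × RSeq} (h : LowE T c C v)
    (hv : ∀ k, v k = v' k + e k) (hv' : ∀ k, memZ2 (v' k)) (he : ∀ k, memZ2 (e k))
    (hs : ∀ k, Z2norm (e k) ≤ (1 / 26) ^ (k + 1)) :
    LowE T (c / 169) (B + C / 13 + c / 13) v' := by
  intro φ hφ N A a ha
  have h0 := h φ hφ N A a ha
  obtain ⟨e1, e2⟩ := Z2_err he hs hφ ha N
  have v1 : memZ2 (∑ k ∈ Finset.range N, a k • v' (φ k)) := Z2_sum (fun k => Z2_smul _ (hv' _)) N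
  have hsum : ∑ k ∈ Finset.range N, a k • v (φ k) = ∑ k ∈ Finset.range N, a k • v' (φ k)
      + ∑ k ∈ Finset.range N, a k • e (φ k) := by
    rw [← Finset.sum_add_distrib]
    exact Finset.sum_congr rfl fun k _ => by rw [hv, smul_add]
  set P := ∑ k ∈ Finset.range N, a k • v' (φ k)
  set E := ∑ k ∈ Finset.range N, a k • e (φ k)
  rw [hsum, map_add] at h0
  have i1 := (Z2_add (hTm _ v1) (hTm _ e1)).2
  have i2 := hB _ e1
  have i3 := (Z2_sub (Z2_add v1 e1).1 e1).2
  rw [add_sub_cancel_right] at i3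
  have i4 : B * Z2norm E ≤ B * A := by gcongr
  have i5 : c * Z2norm P ≤ c * (13 * (Z2norm (P + E) + A)) := by
    gcongr
    linarith
  linarith

def DJP (v : ℕ → RSeq × RSeq) : Prop := ∀ j k n, j ≠ k →
  ((v j).1 n = 0 ∧ (v j).2 n = 0) ∨ ((v k).1 n = 0 ∧ (v k).2 n = 0)

lemma exists_vec {V : Submodule ℝ (RSeq × RSeq)} (hV : ¬ FiniteDimensional ℝ V)
    (hZ : ∀ v ∈ V, memZ2 v) (m : ℕ) : ∃ v ∈ V, Z2norm v = 1 ∧ ∀ n < m, v.1 n = 0 ∧ v.2 n = 0 := by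
  let F : V →ₗ[ℝ] (Fin m → ℝ × ℝ) :=
    { toFun := fun v i => (v.1.1 i, v.1.2 i)
      map_add' := fun _ _ => rfl
      map_smul' := fun _ _ => rfl }
  have hF : ¬ Function.Injective F := fun h => hV (Module.Finite.of_injective F h)
  rw [← LinearMap.ker_eq_bot, ← ne_eq, Submodule.ne_bot_iff] at hF
  obtain ⟨v, hv, hv0⟩ := hF
  have hv1 : (v : RSeq × RSeq) ≠ 0 := fun h => hv0 (Subtype.ext h)
  have hp := Z2_pos (hZ v v.2) hv1
  refine ⟨(1 / Z2norm v.1) • v.1, V.smul_mem _ v.2, ?_, ?_⟩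
  · rw [Z2norm_smul, abs_of_pos (by positivity)]; field_simp
  · intro n hn
    have h1 := congrFun (LinearMap.mem_ker.1 hv) ⟨n, hn⟩
    have h2 : v.1.1 n = 0 := congrArg Prod.fst h1
    have h3 : v.1.2 n = 0 := congrArg Prod.snd h1
    simp [h2, h3]

lemma exists_blocks {T : LinP} {B : ℝ} (hB0 : 0 ≤ B) (hTm : ∀ u, memZ2 u → memZ2 (T u))
    (hB : ∀ u, memZ2 u → Z2norm (T u) ≤ B * Z2norm u)
    {V : Submodule ℝ (RSeq × RSeq)} (hV : ¬ FiniteDimensional ℝ V)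
    (hZ : ∀ v ∈ V, memZ2 v) {c : ℝ} (hc : 0 < c)
    (hlow : ∀ v ∈ V, c * Z2norm v ≤ Z2norm (T v)) :
    ∃ v : ℕ → RSeq × RSeq, (∀ k, FS (v k).1 ∧ FS (v k).2) ∧ DJP v ∧
      (∀ k, 1 / 26 ≤ Z2norm (v k) ∧ Z2norm (v k) ≤ 14) ∧ ∃ c' > 0, ∃ C', LowE T c' C' v := by
  have step : ∀ k m : ℕ, ∃ p : (RSeq × RSeq) × ℕ, p.1 ∈ V ∧ Z2norm p.1 = 1 ∧
      (∀ n < m, p.1.1 n = 0 ∧ p.1.2 n = 0) ∧ m ≤ p.2 ∧ memZ2 (tlp p.2 p.1) ∧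
      Z2norm (tlp p.2 p.1) ≤ (1 / 26) ^ (k + 1) := by
    intro k m
    obtain ⟨v, h1, h2, h3⟩ := exists_vec hV hZ m
    obtain ⟨m0, hm0⟩ := Z2_tail (hZ v h1) (show (0:ℝ) < (1 / 26) ^ (k + 1) by positivity)
    exact ⟨(v, max m m0), h1, h2, h3, le_max_left _ _, hm0 _ (le_max_right _ _)⟩
  choose f hf using step
  let M : ℕ → ℕ := fun k => Nat.rec 0 (fun k m => (f k m).2) k
  have hM : ∀ k, M (k + 1) = (f k (M k)).2 := fun k => rfl
  let w : ℕ → RSeq × RSeq := fun k => (f k (M k)).1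
  have hmono : Monotone M := monotone_nat_of_le_succ fun k => by
    rw [hM]; exact (hf k (M k)).2.2.2.1
  let v : ℕ → RSeq × RSeq := fun k => hdp (M (k + 1)) (w k)
  let e : ℕ → RSeq × RSeq := fun k => tlp (M (k + 1)) (w k)
  have hw : ∀ k, w k = v k + e k := fun k => (hdp_add_tlp _ _).symm
  have he : ∀ k, memZ2 (e k) := fun k => (hf k (M k)).2.2.2.2.1
  have hes : ∀ k, Z2norm (e k) ≤ (1 / 26) ^ (k + 1) := fun k => (hf k (M k)).2.2.2.2.2
  have hes' : ∀ k, Z2norm (e k) ≤ 1 / 26 := fun k => (hes k).trans (by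
    have := pow_le_pow_of_le_one (a := (1:ℝ) / 26) (by norm_num) (by norm_num)
      (show 1 ≤ k + 1 by omega)
    simpa using this)
  have hfs : ∀ k, FS (v k).1 ∧ FS (v k).2 := fun k => ⟨hd_FS _ _, hd_FS _ _⟩
  have hvm : ∀ k, memZ2 (v k) := fun k => Z2_FS (hfs k).1 (hfs k).2
  have hlo : ∀ k n, n < M k → (v k).1 n = 0 ∧ (v k).2 n = 0 := fun k n hn => by
    have := (hf k (M k)).2.2.1 n hn
    simp [v, hdp, hd, w, this]
  have hhi : ∀ k n, M (k + 1) ≤ n → (v k).1 n = 0 ∧ (v k).2 n = 0 := fun k n hn => by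
    simp [v, hdp, hd, not_lt.2 hn]
  refine ⟨v, hfs, ?_, ?_, c / 169, by positivity, _, LowE.perturb hB0 hTm hB hc (C := 0) (v := w) ?_ hw
    hvm he hes⟩
  · have key : ∀ j k n, j < k → ((v j).1 n = 0 ∧ (v j).2 n = 0) ∨ ((v k).1 n = 0 ∧ (v k).2 n = 0) := by
      intro j k n hjk
      rcases lt_or_ge n (M k) with h | h
      · exact Or.inr (hlo k n h)
      · exact Or.inl (hhi j n ((hmono (show j + 1 ≤ k from hjk)).trans h))
    intro j k n hjk
    rcases lt_or_gt_of_ne hjk with h | h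
    · exact key j k n h
    · exact (key k j n h).symm
  · intro k
    have h1 : Z2norm (w k) = 1 := (hf k (M k)).2.1
    have h2 := (Z2_add (hvm k) (he k)).2
    have h3 := (Z2_sub (Z2_add (hvm k) (he k)).1 (he k)).2
    rw [add_sub_cancel_right] at h3
    rw [← hw, h1] at h2 h3
    have := hes' k
    constructor <;> linarith
  · intro φ hφ N A a ha
    rw [zero_mul, add_zero]
    apply hlow
    exact V.sum_mem fun k _ => V.smul_mem _ (hf _ _).1

lemma sum_inl (a : ℕ → ℝ) (y : ℕ → RSeq) (N : ℕ) :
    ∑ k ∈ Finset.range N, a k • ((y k, 0) : RSeq × RSeq)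
      = (∑ k ∈ Finset.range N, a k • y k, 0) := by
  apply Prod.ext
  · simp [Prod.fst_sum]
  · simp [Prod.snd_sum]

lemma exists_log_gt (R : ℝ) : ∃ N0 : ℕ, 1 ≤ N0 ∧ ∀ N : ℕ, N0 ≤ N → R < Real.log N := by
  have h := (Real.tendsto_log_atTop.comp tendsto_natCast_atTop_atTop).eventually
    (Filter.eventually_gt_atTop R)
  obtain ⟨N0, hN0⟩ := Filter.eventually_atTop.1 h
  exact ⟨max 1 N0, le_max_left _ _, fun N hN => hN0 N ((le_max_right _ _).trans hN)⟩

lemma exists_sqrt_small (R : ℝ) {η : ℝ} (hη : 0 < η) :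
    ∃ N0 : ℕ, 1 ≤ N0 ∧ ∀ N : ℕ, N0 ≤ N → R * (1 / Real.sqrt N) < η := by
  have h0 : Filter.Tendsto (fun N : ℕ => R * (1 / Real.sqrt N)) Filter.atTop (nhds (R * 0)) := by
    apply Filter.Tendsto.const_mul
    simp only [one_div]
    exact (Real.tendsto_sqrt_atTop.comp tendsto_natCast_atTop_atTop).inv_tendsto_atTop
  rw [mul_zero] at h0
  obtain ⟨N0, hN0⟩ := Filter.eventually_atTop.1 (h0.eventually (gt_mem_nhds hη))
  exact ⟨max 1 N0, le_max_left _ _, fun N hN => hN0 N ((le_max_right _ _).trans hN)⟩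

lemma ss_of_HH {T : LinP} (hT : BoundedOnZ2 T) (hH : HH T) : StrictlySingular T := by
  obtain ⟨hTm, B', hB'⟩ := hT
  obtain ⟨B, hB0, hB⟩ : ∃ B, 0 ≤ B ∧ ∀ u, memZ2 u → Z2norm (T u) ≤ B * Z2norm u :=
    ⟨|B'|, abs_nonneg _, fun u hu => (hB' u hu).trans
      (mul_le_mul_of_nonneg_right (le_abs_self _) (Z2norm_nonneg _))⟩
  rintro V hZ ⟨c0, hc0, hlow⟩
  by_contra hV
  obtain ⟨v, hfs, hdj, hnm, c, hc, C, hLE⟩ := exists_blocks hB0 hTm hB hV hZ hc0 hlow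
  have hvm : ∀ k, memZ2 (v k) := fun k => Z2_FS (hfs k).1 (hfs k).2
  by_cases hcase : ∃ c1 > 0, ∃ᶠ k in Filter.atTop, c1 ≤ l2norm (v k).2
  · -- second coordinates bounded below
    obtain ⟨c1, hc1, hfr⟩ := hcase
    obtain ⟨ψ, hψ, hψ1⟩ := Filter.extraction_of_frequently_atTop hfr
    let t : ℕ → ℝ := fun k => 1 / l2norm (v (ψ k)).2
    have hpos : ∀ k, 0 < l2norm (v (ψ k)).2 := fun k => hc1.trans_le (hψ1 k)
    have ht0 : ∀ k, 0 < t k := fun k => one_div_pos.2 (hpos k)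
    have ht : ∀ k, |t k| ≤ 1 / c1 := fun k => by
      rw [abs_of_pos (ht0 k)]; exact one_div_le_one_div_of_le hc1 (hψ1 k)
    let u : ℕ → RSeq × RSeq := fun k => t k • v (ψ k)
    have hu : LowE T c (C * (1 / c1)) u := (hLE.comp hψ).scale ht
    set C1 := C * (1 / c1)
    let x : ℕ → RSeq := fun k => (u k).2
    let b : ℕ → RSeq := fun k => (u k).1 - KP (u k).2
    have hx : NB x := by
      refine ⟨fun k => ((hfs _).2).smul _, ?_, ?_⟩
      · intro j k n hjk
        rcases hdj (ψ j) (ψ k) n (hψ.injective.ne hjk) with h | h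
        · left; simp [x, u, h.2]
        · right; simp [x, u, h.2]
      · intro k
        simp only [x, u, Prod.smul_snd]
        rw [l2norm_smul, abs_of_pos (ht0 k)]
        simp only [t]
        have := hpos k
        field_simp
    have hbfs : ∀ k, FS (b k) := fun k => ((hfs _).1.smul _).sub ((hfs _).2.smul _).KP
    have hbdj : DJ b := by
      intro j k n hjk
      rcases hdj (ψ j) (ψ k) n (hψ.injective.ne hjk) with h | h
      · left; simp [b, u, KP, h.1, h.2]
      · right; simp [b, u, KP, h.1, h.2]
    set B2 : ℝ := 1 / c1 * 14 with hB2
    have hB2' : 0 ≤ B2 := by positivity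
    have hbn : ∀ k, l2norm (b k) ≤ B2 := fun k => by
      have h1 : l2norm (b k) ≤ Z2norm (u k) := le_add_of_nonneg_right (l2norm_nonneg _)
      refine h1.trans ?_
      simp only [u]
      rw [Z2norm_smul]
      exact mul_le_mul (ht k) (hnm _).2 (Z2norm_nonneg _) (by positivity)
    obtain ⟨N0, hN01, hN0⟩ := exists_log_gt ((c * B2 + 13 * B * B2 + 169 * B + |C1|) / (c / 2))
    obtain ⟨φ, hφ, N, hN, s, hs, hsm⟩ := hH x hx (c / 338) (by positivity) N0
    have hNpos : 0 < N := by omega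
    have hlog := hN0 N hN
    rw [div_lt_iff₀ (by positivity)] at hlog
    have hlogN : 0 ≤ Real.log N := Real.log_natCast_nonneg N
    have hxφ := hx.comp hφ
    have h1 := hu φ hφ N (1 / Real.sqrt N) (fun k => s k / Real.sqrt N) (fun k => (hs.abs_div N k).le)
    set X := comb N s (x ∘ φ) with hX
    set Bb := comb N s (b ∘ φ) with hBb
    have hXn : l2norm X = 1 := hxφ.comb_norm hNpos hs
    have hXm : memL2 X := (comb_FS hxφ.fs N s).memL2
    have hBn : l2norm Bb ≤ B2 := comb_norm_le (hbdj.comp hφ) (fun k => (hbfs _).memL2) hB2'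
      (fun k => hbn _) hs
    have hBm : memL2 Bb := (comb_FS (fun k => hbfs _) N s).memL2
    have hdec : ∑ k ∈ Finset.range N, (s k / Real.sqrt N) • u (φ k)
        = (Bb, 0) + ((KP X, X) + Real.log N • (X, 0)) := by
      have hu' : ∀ k, u k = (b k + KP (x k), x k) := fun k => by
        apply Prod.ext
        · simp [b, x]
        · rfl
      apply Prod.ext
      · rw [Prod.fst_sum]
        simp only [Prod.smul_fst, Prod.fst_add]
        rw [hX, hxφ.comb_KP hNpos hs, sub_add_cancel, hBb]
        simp only [comb]
        rw [← Finset.sum_add_distrib]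
        refine Finset.sum_congr rfl fun k _ => ?_
        rw [hu', smul_add]; rfl
      · rw [Prod.snd_sum]
        simp only [Prod.smul_snd, Prod.snd_add, smul_zero, add_zero, zero_add]
        rfl
    rw [hdec] at h1
    have hlow2 : Real.log N - B2 ≤ Z2norm ((Bb, 0) + ((KP X, X) + Real.log N • (X, 0))) := by
      have e1 : ((Bb, 0) + ((KP X, X) + Real.log N • ((X, 0) : RSeq × RSeq))).1
          - KP ((Bb, 0) + ((KP X, X) + Real.log N • ((X, 0) : RSeq × RSeq))).2
          = Bb + Real.log N • X := by
        simp only [Prod.fst_add, Prod.snd_add, Prod.smul_fst, Prod.smul_snd, smul_zero, add_zero,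
          zero_add]
        abel
      unfold Z2norm
      rw [e1]
      have h2 := (l2_sub (l2_add hBm (memL2_smul (Real.log N) hXm)).1 hBm).2
      rw [add_sub_cancel_left, l2norm_smul, hXn, abs_of_nonneg hlogN, mul_one] at h2
      have := l2norm_nonneg ((Bb, 0) + ((KP X, X) + Real.log N • ((X, 0) : RSeq × RSeq))).2
      linarith
    have m1 := Z2_inl hBm
    have m2 := Z2_KP hXm
    have m3 := Z2_inl hXm
    rw [map_add, map_add, map_smul] at h1
    have k1 := Z2_add (hTm _ m2) (Z2_smul (Real.log N) (hTm _ m3))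
    have k2 := (Z2_add (hTm _ m1) k1.1).2
    have k1' := k1.2
    rw [Z2norm_smul, abs_of_nonneg hlogN] at k1'
    have l1 := hB _ m1
    have l2 := hB _ m2
    rw [Z2norm_inl] at l1
    rw [Z2norm_KP, hXn] at l2
    have l3 : B * l2norm Bb ≤ B * B2 := by gcongr
    have l4 : Real.log N * Z2norm (T (X, 0)) ≤ Real.log N * (c / 338) := by gcongr
    have l5 : C1 * (1 / Real.sqrt N) ≤ |C1| := by
      have h5 : 1 / Real.sqrt N ≤ 1 := by
        rw [div_le_one (Real.sqrt_pos.2 (by exact_mod_cast hNpos))]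
        rw [Real.one_le_sqrt]; exact_mod_cast hNpos
      calc C1 * (1 / Real.sqrt N) ≤ |C1| * (1 / Real.sqrt N) := by
            gcongr; exact le_abs_self _
        _ ≤ |C1| * 1 := by gcongr
        _ = |C1| := mul_one _
    have l6 := mul_le_mul_of_nonneg_left hlow2 hc.le
    linarith
  · push Not at hcase
    have hev : ∀ k : ℕ, ∀ᶠ n in Filter.atTop, l2norm (v n).2 < (1 / 26) ^ (k + 1) / 2 := fun k => by
      have := hcase ((1 / 26) ^ (k + 1) / 2) (by positivity)
      simpa [Filter.Frequently] using this
    obtain ⟨ψ, hψ, hψ1⟩ := Filter.extraction_forall_of_eventually hev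
    let b : ℕ → RSeq := fun k => (v (ψ k)).1 - KP (v (ψ k)).2
    have hbfs : ∀ k, FS (b k) := fun k => (hfs _).1.sub (hfs _).2.KP
    have hbdj : DJ b := by
      intro j k n hjk
      rcases hdj (ψ j) (ψ k) n (hψ.injective.ne hjk) with h | h
      · left; simp [b, KP, h.1, h.2]
      · right; simp [b, KP, h.1, h.2]
    have hsmall : ∀ k : ℕ, ((1:ℝ) / 26) ^ (k + 1) ≤ 1 / 26 := fun k => by
      have := pow_le_pow_of_le_one (a := (1:ℝ) / 26) (by norm_num) (by norm_num)
        (show 1 ≤ k + 1 by omega)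
      simpa using this
    have hbn : ∀ k, 1 / 52 ≤ l2norm (b k) := fun k => by
      have h1 := (hnm (ψ k)).1
      have h2 := hψ1 k
      have h3 := hsmall k
      unfold Z2norm at h1
      simp only [b]
      linarith
    have hbpos : ∀ k, 0 < l2norm (b k) := fun k => lt_of_lt_of_le (by norm_num) (hbn k)
    have hL2 := LowE.perturb hB0 hTm hB hc (v := v ∘ ψ) (v' := fun k => (b k, 0))
      (e := fun k => (KP (v (ψ k)).2, (v (ψ k)).2)) (hLE.comp hψ)
      (fun k => Prod.ext (by simp [b]) (by simp)) (fun k => Z2_inl (hbfs k).memL2)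
      (fun k => Z2_KP (hfs _).2.memL2) (fun k => by
        rw [Z2norm_KP]
        have h2 := hψ1 k
        have : (0:ℝ) < (1 / 26) ^ (k + 1) := by positivity
        linarith)
    have hL3 := hL2.scale (t := fun k => 1 / l2norm (b k)) (τ := 52) (fun k => by
      rw [abs_of_pos (one_div_pos.2 (hbpos k)), div_le_iff₀ (hbpos k)]
      have := hbn k
      linarith)
    set c2 := c / 169
    have hc2 : 0 < c2 := by positivity
    set C2 := (B + C / 13 + c / 13) * 52
    let y : ℕ → RSeq := fun k => (1 / l2norm (b k)) • b k
    have hy : NB y := by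
      refine ⟨fun k => (hbfs k).smul _, ?_, ?_⟩
      · intro j k n hjk
        rcases hbdj j k n hjk with h | h
        · left; simp [y, h]
        · right; simp [y, h]
      · intro k
        simp only [y]
        rw [l2norm_smul, abs_of_pos (one_div_pos.2 (hbpos k))]
        have := hbpos k
        field_simp
    obtain ⟨N0, hN01, hN0⟩ := exists_sqrt_small C2 (show 0 < c2 / 4 by positivity)
    obtain ⟨φ, hφ, N, hN, s, hs, hsm⟩ := hH y hy (c2 / 4) (by positivity) N0
    have hNpos : 0 < N := by omega
    have h1 := hL3 φ hφ N (1 / Real.sqrt N) (fun k => s k / Real.sqrt N) (fun k => (hs.abs_div N k).le)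
    have hdec : ∑ k ∈ Finset.range N, (s k / Real.sqrt N) • (1 / l2norm (b (φ k))) •
        ((b (φ k), 0) : RSeq × RSeq) = (comb N s (y ∘ φ), 0) := by
      rw [comb, ← sum_inl]
      refine Finset.sum_congr rfl fun k _ => ?_
      simp [y]
    rw [hdec, Z2norm_inl, (hy.comp hφ).comb_norm hNpos hs] at h1
    have := hN0 N hN
    linarith

/-! ### Scalar lemmas -/

lemma dual_scalar {a b : ℝ} (ha : 0 < a) (hb : 0 < b) :
    a * b * |Real.log b - Real.log a| ≤ a ^ 2 + b ^ 2 := by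
  rcases le_total a b with h | h
  · have := mul_le_mul_of_nonneg_right (aux_log' ha h) hb.le
    nlinarith [sq_nonneg a]
  · have := mul_le_mul_of_nonneg_right (aux_log' hb h) ha.le
    rw [abs_sub_comm] at this
    nlinarith [sq_nonneg b]

lemma dual_le {p x : RSeq} (hp : memL2 p) (hKp : memL2 (KP p)) (hx : memL2 x)
    (hx1 : l2norm x = 1) (J : Finset ℕ) :
    |∑ n ∈ J, p n * KP x n| ≤ l2norm (KP p) + 4 * l2norm p := by
  rcases (l2norm_nonneg p).eq_or_lt with h | hρ
  · have := eq_zero_of_l2 hp h.symm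
    subst this
    simp [KP_zero, l2norm_zero]
  set ρ := l2norm p with hρ'
  have hpt : ∀ n, |p n * KP x n - x n * KP p n| ≤ 2 / ρ * (p n) ^ 2 + 2 * ρ * (x n) ^ 2 := by
    intro n
    rw [KP_eq (by rw [hx1]; norm_num), KP_eq hρ.ne', hx1, ← hρ', Real.log_one]
    rcases eq_or_ne (p n) 0 with h | h
    · simp [h]; positivity
    rcases eq_or_ne (x n) 0 with h' | h'
    · simp [h']; positivity
    have hp0 := abs_pos.2 h
    have := dual_scalar (a := |p n| / ρ) (b := |x n|) (by positivity) (abs_pos.2 h')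
    rw [Real.log_div hp0.ne' hρ.ne', Real.log_abs, Real.log_abs] at this
    have e : p n * (2 * (x n * Real.log (x n)) - 2 * (x n * 0)) -
        x n * (2 * (p n * Real.log (p n)) - 2 * (p n * Real.log ρ)) =
        2 * (p n * x n * (Real.log (x n) - (Real.log (p n) - Real.log ρ))) := by ring
    rw [e, abs_mul, abs_mul, abs_mul, abs_two]
    calc 2 * (|p n| * |x n| * |Real.log (x n) - (Real.log (p n) - Real.log ρ)|)
        = 2 * ρ * (|p n| / ρ * |x n| * |Real.log (x n) - (Real.log (p n) - Real.log ρ)|) := by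
          field_simp
      _ ≤ 2 * ρ * ((|p n| / ρ) ^ 2 + |x n| ^ 2) := by gcongr
      _ = _ := by rw [div_pow, sq_abs, sq_abs]; field_simp
  have h1 : |∑ n ∈ J, p n * KP x n - ∑ n ∈ J, x n * KP p n| ≤ 4 * ρ := by
    rw [← Finset.sum_sub_distrib]
    refine (Finset.abs_sum_le_sum_abs _ _).trans ((Finset.sum_le_sum fun n _ => hpt n).trans ?_)
    rw [Finset.sum_add_distrib, ← Finset.mul_sum, ← Finset.mul_sum]
    have a1 := fin_le hp J
    have a2 := fin_le hx J
    rw [hx1] at a2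
    calc 2 / ρ * ∑ n ∈ J, (p n) ^ 2 + 2 * ρ * ∑ n ∈ J, (x n) ^ 2
        ≤ 2 / ρ * ρ ^ 2 + 2 * ρ * 1 ^ 2 := by gcongr
      _ = 4 * ρ := by field_simp; ring
  have h2 := l2_cs' hx hKp J
  rw [hx1, one_mul] at h2
  rw [abs_le] at *
  constructor <;> linarith [h1.1, h1.2, h2.1, h2.2]

lemma flat_pair {p x : RSeq} (hp : memL2 p) (hKp : memL2 (KP p)) (hx : memL2 x)
    (hx1 : l2norm x = 1) {L : ℝ} (hL : 0 ≤ L) (hs : ∀ n, |x n| ≤ Real.exp (-(2 * L)))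
    (J : Finset ℕ) : L * |∑ n ∈ J, p n * x n| ≤ l2norm (KP p) + l2norm p := by
  rcases (l2norm_nonneg p).eq_or_lt with h | hρ
  · have := eq_zero_of_l2 hp h.symm
    subst this
    simp [KP_zero, l2norm_zero]
  set ρ := l2norm p with hρ'
  have hpt : ∀ n, L * (|p n| * |x n|) ≤ |KP p n| * |x n| + 1 / ρ * (p n) ^ 2 := by
    intro n
    rcases eq_or_ne (p n) 0 with h | h
    · simp [h]; positivity
    have hp0 := abs_pos.2 h
    rcases le_total (|p n|) (ρ * Real.exp (-L)) with hc | hc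
    · have h1 : L * |p n| ≤ |KP p n| := by
        have hl : Real.log (p n) ≤ Real.log ρ - L := by
          have := Real.log_le_log hp0 hc
          rwa [Real.log_abs, Real.log_mul hρ.ne' (Real.exp_pos _).ne', Real.log_exp] at this
        unfold KP
        rw [← hρ', abs_mul, abs_mul, abs_two, Real.log_div hp0.ne' hρ.ne', Real.log_abs, abs_sub_comm]
        have h2 : L ≤ |Real.log ρ - Real.log (p n)| := le_trans (by linarith) (le_abs_self _)
        nlinarith
      have := mul_le_mul_of_nonneg_right h1 (abs_nonneg (x n))
      have h3 : 0 ≤ 1 / ρ * (p n) ^ 2 := by positivity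
      linarith
    · have h1 : L * Real.exp (-L) ≤ 1 := by
        have := Real.add_one_le_exp L
        rw [Real.exp_neg, ← div_eq_mul_inv, div_le_one (Real.exp_pos _)]
        linarith
      have h2 : |x n| ≤ Real.exp (-L) * (|p n| / ρ) := by
        refine (hs n).trans ?_
        rw [show -(2 * L) = -L + -L by ring, Real.exp_add]
        gcongr
        rw [le_div_iff₀ hρ]; linarith
      have h3 : 0 ≤ |KP p n| * |x n| := by positivity
      have h4 : L * (|p n| * |x n|) ≤ 1 / ρ * (p n) ^ 2 := by
        calc L * (|p n| * |x n|) ≤ L * (|p n| * (Real.exp (-L) * (|p n| / ρ))) := by gcongr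
          _ = (L * Real.exp (-L)) * (1 / ρ * |p n| ^ 2) := by field_simp
          _ ≤ 1 * (1 / ρ * |p n| ^ 2) := by gcongr
          _ = _ := by rw [sq_abs, one_mul]
      linarith
  have h1 : |∑ n ∈ J, p n * x n| ≤ ∑ n ∈ J, |p n| * |x n| := by
    refine (Finset.abs_sum_le_sum_abs _ _).trans ?_
    simp only [abs_mul]; exact le_rfl
  calc L * |∑ n ∈ J, p n * x n| ≤ L * ∑ n ∈ J, |p n| * |x n| := by gcongr
    _ = ∑ n ∈ J, L * (|p n| * |x n|) := Finset.mul_sum _ _ _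
    _ ≤ ∑ n ∈ J, (|KP p n| * |x n| + 1 / ρ * (p n) ^ 2) := Finset.sum_le_sum fun n _ => hpt n
    _ = ∑ n ∈ J, |KP p n| * |x n| + 1 / ρ * ∑ n ∈ J, (p n) ^ 2 := by
        rw [Finset.sum_add_distrib, ← Finset.mul_sum]
    _ ≤ l2norm (KP p) * l2norm x + 1 / ρ * ρ ^ 2 := by
        gcongr
        · exact l2_cs hKp hx J
        · exact fin_le hp J
    _ = _ := by rw [hx1]; field_simp

/-- `X` is a restriction of `KP z`. -/
lemma KPKP_point {z X : RSeq} (hz : memL2 z) (hR : l2norm z ≤ l2norm X)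
    (hX : ∀ n, X n = 0 ∨ X n = KP z n) (n : ℕ) : (X n) ^ 2 / 4 ≤ z n * KP X n := by
  rcases eq_or_ne (X n) 0 with h0 | h0
  · simp [KP, h0]
  have hXn := (hX n).resolve_left h0
  have hzn : z n ≠ 0 := by
    intro h; apply h0; rw [hXn]; simp [KP, h]
  have hz0 := abs_pos.2 hzn
  have hle := abs_le_l2 hz n
  have hρ : 0 < l2norm z := hz0.trans_le hle
  have hR0 : 0 < l2norm X := hρ.trans_le hR
  set lam := Real.log (l2norm z) - Real.log (z n) with hlam
  have hlam0 : 0 ≤ lam := by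
    have := Real.log_le_log hz0 hle
    rw [Real.log_abs] at this
    linarith
  have hX2 : X n = - 2 * (z n * lam) := by
    rw [hXn, KP_eq hρ.ne']; ring
  have hlam1 : 0 < lam := by
    refine lt_of_le_of_ne hlam0 fun h => h0 ?_
    rw [hX2, ← h]; ring
  have hlogX : Real.log (X n) = Real.log (2 * lam) + Real.log (z n) := by
    rw [hX2, show - 2 * (z n * lam) = -((2 * lam) * z n) by ring, Real.log_neg_eq_log,
      Real.log_mul (by positivity) hzn]
  have hb : Real.log (2 * lam) ≤ 3 / 4 * lam := by
    have h1 := Real.log_le_sub_one_of_pos (show 0 < 3 / 4 * lam by positivity)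
    have h2 : Real.log (2 * lam) = Real.log (8 / 3) + Real.log (3 / 4 * lam) := by
      rw [← Real.log_mul (by norm_num) (by positivity)]; congr 1; ring
    have h3 : Real.log (8 / 3) ≤ 1 := by
      rw [Real.log_le_iff_le_exp (by norm_num)]
      have := Real.exp_one_gt_d9
      linarith
    linarith
  have hlogR := Real.log_le_log hρ hR
  have hfin : Real.log (X n) - Real.log (l2norm X) ≤ - (lam / 4) := by
    rw [hlogX]; linarith
  rw [KP_eq hR0.ne']
  have e : z n * (2 * (X n * Real.log (X n)) - 2 * (X n * Real.log (l2norm X)))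
      = 4 * ((z n) ^ 2 * lam) * (-(Real.log (X n) - Real.log (l2norm X))) := by
    conv_lhs => rw [show 2 * (X n * Real.log (X n)) - 2 * (X n * Real.log (l2norm X))
      = 2 * X n * (Real.log (X n) - Real.log (l2norm X)) by ring]
    generalize Real.log (X n) - Real.log (l2norm X) = q
    rw [hX2]; ring
  rw [e]
  have h5 : (X n) ^ 2 / 4 = 4 * ((z n) ^ 2 * lam) * (lam / 4) := by rw [hX2]; ring
  rw [h5]
  gcongr
  linarith

lemma l2norm_sq_fin {x : RSeq} {m : ℕ} (h : ∀ n, m ≤ n → x n = 0) :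
    l2norm x ^ 2 = ∑ n ∈ Finset.range m, (x n) ^ 2 := by
  rw [l2norm_sq]
  apply tsum_eq_sum
  intro n hn
  rw [h n (by simpa using hn)]; simp

lemma flat_inl {y : RSeq} (hy : FS y) (hn : l2norm y ≤ 1) {L : ℝ} (hL : 1 ≤ L)
    (hs : ∀ n, |y n| ≤ Real.exp (-L)) : ∃ x, FS x ∧ Z2norm (y, x) ≤ 8 / Real.sqrt L := by
  have hL0 : 0 < L := by linarith
  have hsL : 0 < Real.sqrt L := Real.sqrt_pos.2 hL0
  rcases eq_or_ne y 0 with rfl | hy0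
  · refine ⟨0, FS.zero, ?_⟩
    have : Z2norm ((0 : RSeq), (0 : RSeq)) = 0 := Z2_zero.2
    rw [this]; positivity
  have hlog : ∀ n, y n ≠ 0 → Real.log (y n) ≤ -L := by
    intro n h
    have := Real.log_le_log (abs_pos.2 h) (hs n)
    rwa [Real.log_abs, Real.log_exp] at this
  let x : RSeq := fun n => y n / (2 * Real.log (y n))
  have hxfs : FS x := hy.mono fun n h => by simp [x, h]
  have hr : l2norm x ≤ 1 / (2 * L) := by
    have h1 := l2_mono (x := x) (memL2_smul (1 / (2 * L)) hy.memL2) fun n => by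
      rcases eq_or_ne (y n) 0 with h | h
      · simp [x, h]
      · have h2 := hlog n h
        simp only [x, Pi.smul_apply, smul_eq_mul]
        rw [abs_div, abs_mul, abs_mul, abs_two, abs_of_pos (show 0 < 1 / (2 * L) by positivity),
          abs_of_nonpos (show Real.log (y n) ≤ 0 by linarith), div_eq_mul_one_div, mul_comm]
        gcongr
        linarith
    refine h1.2.trans ?_
    rw [l2norm_smul, abs_of_pos (by positivity)]
    exact mul_le_of_le_one_right (by positivity) hn
  have hr0 : 0 < l2norm x := by
    refine lt_of_le_of_ne (l2norm_nonneg x) fun h => hy0 ?_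
    have hx0 := eq_zero_of_l2 hxfs.memL2 h.symm
    funext n
    by_contra hyn
    have h1 := congrFun hx0 n
    have h2 := hlog n hyn
    simp only [x, Pi.zero_apply, div_eq_zero_iff] at h1
    rcases h1 with h1 | h1
    · exact hyn h1
    · linarith
  set r := l2norm x with hrdef
  refine ⟨x, hxfs, ?_⟩
  let E : RSeq := fun n => y n * (Real.log (2 * (- Real.log (y n))) / Real.log (y n))
  have hE : memL2 E ∧ l2norm E ≤ 3 / Real.sqrt L := by
    have h1 := l2_mono (x := E) (memL2_smul (3 / Real.sqrt L) hy.memL2) fun n => by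
      rcases eq_or_ne (y n) 0 with h | h
      · simp [E, h]
      have h2 := hlog n h
      simp only [E, Pi.smul_apply, smul_eq_mul]
      rw [abs_mul, abs_mul, abs_div, mul_comm, abs_of_pos (show 0 < 3 / Real.sqrt L by positivity)]
      refine mul_le_mul_of_nonneg_right ?_ (abs_nonneg _)
      set lam := - Real.log (y n) with hlam
      have hl : L ≤ lam := by linarith
      have hl0 : 0 < lam := by linarith
      rw [show Real.log (y n) = -lam by rw [hlam]; ring, abs_neg, abs_of_pos hl0,
        abs_of_nonneg (Real.log_nonneg (by linarith)), div_le_div_iff₀ hl0 hsL]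
      have a1 : Real.log (2 * lam) ≤ 3 * Real.sqrt lam := by
        have b1 := Real.log_le_sub_one_of_pos (Real.sqrt_pos.2 (show 0 < 2 * lam by positivity))
        rw [Real.log_sqrt (by positivity)] at b1
        have b2 : Real.sqrt (2 * lam) ≤ 3 / 2 * Real.sqrt lam := by
          rw [Real.sqrt_le_iff]
          refine ⟨by positivity, ?_⟩
          rw [mul_pow, Real.sq_sqrt hl0.le]; linarith
        linarith
      have a2 : Real.sqrt L ≤ Real.sqrt lam := Real.sqrt_le_sqrt hl
      calc Real.log (2 * lam) * Real.sqrt L ≤ 3 * Real.sqrt lam * Real.sqrt lam := by gcongr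
        _ = 3 * lam := by rw [mul_assoc, Real.mul_self_sqrt hl0.le]
    refine ⟨h1.1, h1.2.trans ?_⟩
    rw [l2norm_smul, abs_of_pos (by positivity)]
    exact mul_le_of_le_one_right (by positivity) hn
  have e : y - KP x = E + (2 * Real.log r) • x := by
    funext n
    simp only [Pi.sub_apply, Pi.add_apply, Pi.smul_apply, smul_eq_mul]
    rw [KP_eq hr0.ne']
    rcases eq_or_ne (y n) 0 with h | h
    · simp [x, E, h]
    have h2 := hlog n h
    have h3 : Real.log (y n) ≠ 0 := by linarith
    have h4 : Real.log (x n) = Real.log (y n) - Real.log (2 * (- Real.log (y n))) := by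
      simp only [x]
      rw [Real.log_div h (by simpa using h3), show 2 * Real.log (y n) = -(2 * (-Real.log (y n))) by ring,
        Real.log_neg_eq_log]
    rw [h4]
    simp only [x, E]
    rw [← hrdef]
    field_simp
    ring
  have h5 := (l2_add hE.1 (memL2_smul (2 * Real.log r) hxfs.memL2)).2
  rw [l2norm_smul, abs_mul, abs_two, ← hrdef] at h5
  have hr1 : r ≤ 1 / L := hr.trans (by gcongr; linarith)
  have hr2 : r ≤ 1 := hr1.trans (by rw [div_le_one hL0]; exact hL)
  have h6 := aux_log2 hr0 hr2
  rw [Real.log_one, zero_sub, abs_neg, Real.sqrt_one, mul_one] at h6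
  have h7 : Real.sqrt r ≤ 1 / Real.sqrt L := by
    rw [show 1 / Real.sqrt L = Real.sqrt (1 / L) by rw [Real.sqrt_div zero_le_one, Real.sqrt_one]]
    exact Real.sqrt_le_sqrt hr1
  have h8 : r ≤ Real.sqrt r := by
    apply Real.le_sqrt_of_sq_le; nlinarith
  show l2norm (y - KP x) + l2norm x ≤ _
  rw [e, ← hrdef]
  have h9 : 8 / Real.sqrt L = 3 / Real.sqrt L + 5 * (1 / Real.sqrt L) := by ring
  rw [h9]
  linarith [hE.2]

lemma exists_signs (m : ℕ → ℕ → ℝ) (N : ℕ) : ∃ s, IsSign s ∧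
    ∑ j ∈ Finset.range N, ∑ k ∈ Finset.range N, s j * s k * m j k ≤ ∑ k ∈ Finset.range N, m k k := by
  induction N with
  | zero => exact ⟨fun _ => 1, fun _ => by simp, by simp⟩
  | succ N ih =>
    obtain ⟨s, hs, h⟩ := ih
    set q := ∑ k ∈ Finset.range N, s k * (m k N + m N k) with hq
    let σ : ℝ := if 0 ≤ q then -1 else 1
    have hσ : |σ| = 1 := by simp only [σ]; split_ifs <;> simp
    have hσ2 : σ * σ = 1 := by simp only [σ]; split_ifs <;> simp
    have hσq : σ * q ≤ 0 := by simp only [σ]; split_ifs <;> linarith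
    let t : ℕ → ℝ := fun k => if k = N then σ else s k
    have htN : t N = σ := by simp [t]
    have ht : ∀ k ∈ Finset.range N, t k = s k := fun k hk => by
      have : k ≠ N := by simp at hk; omega
      simp [t, this]
    refine ⟨t, fun k => ?_, ?_⟩
    · simp only [t]; split_ifs
      · exact hσ
      · exact hs k
    rw [Finset.sum_range_succ, Finset.sum_range_succ _ N, htN]
    simp only [Finset.sum_range_succ _ N, htN]
    rw [Finset.sum_add_distrib, hσ2]
    have e1 : ∑ j ∈ Finset.range N, ∑ k ∈ Finset.range N, t j * t k * m j k
        = ∑ j ∈ Finset.range N, ∑ k ∈ Finset.range N, s j * s k * m j k :=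
      Finset.sum_congr rfl fun j hj => Finset.sum_congr rfl fun k hk => by rw [ht j hj, ht k hk]
    have e2 : ∑ j ∈ Finset.range N, t j * σ * m j N + ∑ k ∈ Finset.range N, σ * t k * m N k
        = σ * q := by
      rw [hq, Finset.mul_sum, ← Finset.sum_add_distrib]
      exact Finset.sum_congr rfl fun k hk => by rw [ht k hk]; ring
    linarith


/-! ### The four cases -/

lemma HH_of_HC {T : LinP} (hTm : ∀ u, memZ2 u → memZ2 (T u))
    (h : ∀ y, NB y → ∀ c > 0, ∃ k, Z2norm (T (y k, 0)) < c) : HH T := by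
  intro y hy ε hε N0
  have hev : ∀ c > 0, ∀ᶠ k in Filter.atTop, Z2norm (T (y k, 0)) < c := by
    intro c hc
    by_contra hcon
    rw [Filter.not_eventually] at hcon
    obtain ⟨φ, hφ, h1⟩ := Filter.extraction_of_frequently_atTop hcon
    obtain ⟨k, hk⟩ := h (y ∘ φ) (hy.comp hφ) c hc
    exact h1 k hk
  obtain ⟨ψ, hψ, h1⟩ := Filter.extraction_forall_of_eventually
    (fun k : ℕ => hev ((1 / 26) ^ (k + 1)) (by positivity))
  obtain ⟨N1, _, hN1⟩ := exists_sqrt_small 1 hε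
  have hs : IsSign (fun _ => 1) := fun _ => abs_one
  refine ⟨ψ, hψ, max N0 N1, le_max_left _ _, fun _ => 1, hs, ?_⟩
  have h3 := hN1 _ (le_max_right N0 N1)
  set N := max N0 N1
  have h2 := (Z2_err (u := fun k => T (y (ψ k), 0)) (fun k => hTm _ (Z2_inl (hy.fs _).memL2))
    (fun k => (h1 k).le) strictMono_id (a := fun k => 1 / Real.sqrt N) (A := 1 / Real.sqrt N)
    (fun k => (hs.abs_div _ k).le) N).2
  have e : T (comb N (fun _ => 1) (y ∘ ψ), 0)
      = ∑ k ∈ Finset.range N, (1 / Real.sqrt N) • T (y (ψ k), 0) := by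
    rw [comb, ← sum_inl, map_sum]
    simp only [map_smul]
    rfl
  rw [e]
  simp only [id] at h2
  linarith

lemma pair_signs (p : RSeq × RSeq →ₗ[ℝ] RSeq) {y : ℕ → RSeq} (hy : NB y) {N : ℕ} (hN : 0 < N)
    (G : ℕ → RSeq) (J : Finset ℕ) {c' D : ℝ}
    (h1 : ∀ k < N, c' ≤ ∑ n ∈ J, p (y k, 0) n * G k n)
    (h2 : ∀ k < N, ∑ n ∈ J, p (KP (y k), y k) n * G k n ≤ D) :
    ∃ s, IsSign s ∧ ∑ n ∈ J, p (KP (comb N s y), comb N s y) n * comb N s G n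
      ≤ D - c' * Real.log N := by
  let v : ℕ → RSeq := fun k => p (KP (y k), y k) - Real.log N • p (y k, 0)
  obtain ⟨s, hs, h⟩ := exists_signs (fun j k => ∑ n ∈ J, v j n * G k n) N
  refine ⟨s, hs, ?_⟩
  have hN' : (0:ℝ) < N := by exact_mod_cast hN
  have e : p (KP (comb N s y), comb N s y) = ∑ j ∈ Finset.range N, (s j / Real.sqrt N) • v j := by
    have e1 : ((KP (comb N s y), comb N s y) : RSeq × RSeq)
        = ∑ j ∈ Finset.range N, (s j / Real.sqrt N) •
          ((KP (y j), y j) - Real.log N • ((y j, 0) : RSeq × RSeq)) := by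
      rw [hy.comb_KP hN hs]
      apply Prod.ext
      · rw [Prod.fst_sum]
        simp only [comb, Finset.smul_sum, ← Finset.sum_sub_distrib]
        refine Finset.sum_congr rfl fun k _ => ?_
        simp only [Prod.smul_fst, Prod.fst_sub, smul_sub]
        rw [smul_comm]
      · rw [Prod.snd_sum]
        simp only [comb]
        refine Finset.sum_congr rfl fun k _ => ?_
        simp
    rw [e1, map_sum]
    refine Finset.sum_congr rfl fun k _ => ?_
    rw [map_smul, map_sub, map_smul]
  have e2 : ∑ n ∈ J, p (KP (comb N s y), comb N s y) n * comb N s G n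
      = 1 / N * ∑ j ∈ Finset.range N, ∑ k ∈ Finset.range N, s j * s k * ∑ n ∈ J, v j n * G k n := by
    have e3 : ∀ n, p (KP (comb N s y), comb N s y) n * comb N s G n
        = ∑ j ∈ Finset.range N, ∑ k ∈ Finset.range N, 1 / N * (s j * s k * (v j n * G k n)) := by
      intro n
      rw [e, comb, Finset.sum_apply, Finset.sum_apply, Finset.sum_mul_sum]
      refine Finset.sum_congr rfl fun j _ => Finset.sum_congr rfl fun k _ => ?_
      simp only [Pi.smul_apply, smul_eq_mul]
      have : (1:ℝ) / N = 1 / Real.sqrt N * (1 / Real.sqrt N) := by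
        rw [div_mul_div_comm, Real.mul_self_sqrt hN'.le, one_mul]
      rw [this]
      ring
    simp only [e3]
    rw [Finset.sum_comm, Finset.mul_sum]
    refine Finset.sum_congr rfl fun j _ => ?_
    rw [Finset.sum_comm, Finset.mul_sum]
    refine Finset.sum_congr rfl fun k _ => ?_
    simp only [Finset.mul_sum]
  rw [e2]
  have h3 : ∑ k ∈ Finset.range N, ∑ n ∈ J, v k n * G k n ≤ N * (D - c' * Real.log N) := by
    have h4 : ∀ k ∈ Finset.range N, ∑ n ∈ J, v k n * G k n ≤ D - c' * Real.log N := by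
      intro k hk
      have hk' := Finset.mem_range.1 hk
      have e5 : ∑ n ∈ J, v k n * G k n = ∑ n ∈ J, p (KP (y k), y k) n * G k n
          - Real.log N * ∑ n ∈ J, p (y k, 0) n * G k n := by
        rw [Finset.mul_sum, ← Finset.sum_sub_distrib]
        refine Finset.sum_congr rfl fun n _ => ?_
        simp only [v, Pi.sub_apply, Pi.smul_apply, smul_eq_mul]
        ring
      rw [e5]
      have := mul_le_mul_of_nonneg_left (h1 k hk') (Real.log_natCast_nonneg N)
      have := h2 k hk'
      linarith
    have := Finset.sum_le_card_nsmul _ _ _ h4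
    simpa using this
  calc _ ≤ 1 / (N:ℝ) * (N * (D - c' * Real.log N)) := by
        refine mul_le_mul_of_nonneg_left (h.trans h3) (by positivity)
    _ = _ := by field_simp

lemma lemma_K {p : RSeq × RSeq →ₗ[ℝ] RSeq} {B : ℝ} (hpm : ∀ u, memZ2 u → memL2 (p u))
    (hpB : ∀ u, memZ2 u → l2norm (p u) ≤ B * Z2norm u) {y : ℕ → RSeq} (hy : NB y) {c : ℝ}
    (hc : 0 < c) : ∃ k, l2norm (p (y k, 0)) < c := by
  by_contra hcon
  push Not at hcon
  obtain ⟨N, hN1, hN⟩ := exists_log_gt (2 * B ^ 2 / (c ^ 2 / 2))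
  have hlog := hN N le_rfl
  rw [div_lt_iff₀ (by positivity)] at hlog
  have hz : ∀ k, memL2 (p (y k, 0)) := fun k => hpm _ (Z2_inl (hy.fs k).memL2)
  have hm : ∀ k, ∃ m0, ∀ m, m0 ≤ m → c ^ 2 / 2 ≤ ∑ n ∈ Finset.range m, (p (y k, 0) n) ^ 2 := by
    intro k
    have h1 := (hz k).hasSum.tendsto_sum_nat
    have h2 : c ^ 2 / 2 < ∑' n, (p (y k, 0) n) ^ 2 := by
      rw [← l2norm_sq]
      have := hcon k
      nlinarith [pow_pos hc 2]
    obtain ⟨m0, h3⟩ := Filter.eventually_atTop.1 (h1.eventually (lt_mem_nhds h2))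
    exact ⟨m0, fun m hm => (h3 m hm).le⟩
  choose f hf using hm
  set m := (Finset.range N).sup f with hmdef
  have hY : ∀ s, IsSign s → memZ2 (comb N s y, 0) ∧ memZ2 (KP (comb N s y), comb N s y) ∧
      l2norm (comb N s y) = 1 := fun s hs =>
    ⟨Z2_inl (comb_FS hy.fs N s).memL2, Z2_KP (comb_FS hy.fs N s).memL2, hy.comb_norm hN1 hs⟩
  have hcs : ∀ {a b : RSeq}, memL2 a → memL2 b → l2norm a ≤ B → l2norm b ≤ B →
      |∑ n ∈ Finset.range m, a n * b n| ≤ B ^ 2 := by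
    intro a b ha hb h1 h2
    refine (l2_cs' ha hb _).trans ?_
    rw [sq]
    exact mul_le_mul h1 h2 (l2norm_nonneg _) ((l2norm_nonneg _).trans h1)
  obtain ⟨s, hs, h⟩ := pair_signs p hy hN1 (fun k => p (y k, 0)) (Finset.range m)
    (c' := c ^ 2 / 2) (D := B ^ 2)
    (fun k hk => by
      have := hf k m (Finset.le_sup (Finset.mem_range.2 hk))
      simpa [sq] using this)
    (fun k hk => by
      refine (le_abs_self _).trans (hcs (hpm _ (Z2_KP (hy.fs k).memL2)) (hz k) ?_ ?_)
      · have := hpB _ (Z2_KP (hy.fs k).memL2)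
        rwa [Z2norm_KP, hy.nm, mul_one] at this
      · have := hpB _ (Z2_inl (hy.fs k).memL2)
        rwa [Z2norm_inl, hy.nm, mul_one] at this)
  obtain ⟨m1, m2, m3⟩ := hY s hs
  have e : comb N s (fun k => p (y k, 0)) = p (comb N s y, 0) := by
    rw [comb, comb, ← sum_inl, map_sum]
    simp only [map_smul]
  rw [e] at h
  have h4 := hcs (hpm _ m2) (hpm _ m1)
    (by have := hpB _ m2; rwa [Z2norm_KP, m3, mul_one] at this)
    (by have := hpB _ m1; rwa [Z2norm_inl, m3, mul_one] at this)
  have h5 := neg_le_of_abs_le h4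
  linarith

lemma HH_R {T : LinP} (h : ∀ y, T (y, 0) = 0) : HH T := by
  intro y hy ε hε N0
  refine ⟨id, strictMono_id, N0, le_rfl, fun _ => 1, fun _ => abs_one, ?_⟩
  rw [h, Z2_zero.2]
  exact hε.le

lemma inv_sqrt_eq_exp {N : ℕ} (hN : 0 < N) : 1 / Real.sqrt N = Real.exp (-(Real.log N / 2)) := by
  have hN' : (0:ℝ) < N := by exact_mod_cast hN
  rw [Real.exp_neg, ← Real.log_sqrt hN'.le, Real.exp_log (Real.sqrt_pos.2 hN'), one_div]

lemma HH_S {T : LinP} {B : ℝ} (hB0 : 0 ≤ B)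
    (hB : ∀ u, memZ2 u → Z2norm (T u) ≤ B * Z2norm u) (h : ∀ y x, T (y, x) = T (y, 0)) :
    HH T := by
  intro y hy ε hε N0
  obtain ⟨N1, hN1, hN⟩ := exists_log_gt (2 * max 1 ((B * 8 / ε) ^ 2))
  refine ⟨id, strictMono_id, max N0 N1, le_max_left _ _, fun _ => 1, fun _ => abs_one, ?_⟩
  have hs : IsSign (fun _ => 1) := fun _ => abs_one
  have hlog := hN _ (le_max_right N0 N1)
  have hNpos : 0 < max N0 N1 := lt_of_lt_of_le hN1 (le_max_right _ _)
  set N := max N0 N1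
  set L := Real.log N / 2 with hL
  have hL1 : max 1 ((B * 8 / ε) ^ 2) ≤ L := by linarith
  have hL2 : 1 ≤ L := (le_max_left _ _).trans hL1
  have hL3 := (le_max_right _ _).trans hL1
  have hY : FS (comb N (fun _ => 1) (y ∘ id)) := comb_FS hy.fs N _
  obtain ⟨x, hx, hxn⟩ := flat_inl hY (hy.comb_norm hNpos hs).le hL2 (fun n => by
    rw [hL, ← inv_sqrt_eq_exp hNpos]; exact hy.comb_sup hs n)
  rw [← h _ x]
  refine (hB _ (Z2_FS hY hx)).trans ((mul_le_mul_of_nonneg_left hxn hB0).trans ?_)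
  have hsL : 0 < Real.sqrt L := Real.sqrt_pos.2 (by linarith)
  have h5 : B * 8 / ε ≤ Real.sqrt L := Real.le_sqrt_of_sq_le hL3
  rw [div_le_iff₀ hε] at h5
  rw [← mul_div_assoc, div_le_iff₀ hsL]
  linarith

lemma hd_norm_le {w : RSeq} {A : ℝ} (hA : 0 ≤ A) (h : ∀ n, |w n| ≤ A) (m : ℕ) :
    l2norm (hd m w) ≤ (m + 1) * A := by
  apply abs_le_of_sq_le_sq' _ (by positivity) |>.2
  rw [l2norm_sq_fin (m := m) (fun n hn => by simp [hd, not_lt.2 hn])]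
  have h1 : ∀ n ∈ Finset.range m, (hd m w n) ^ 2 ≤ A ^ 2 := by
    intro n hn
    have : hd m w n = w n := by simp [hd, Finset.mem_range.1 hn]
    rw [this, ← sq_abs]
    exact pow_le_pow_left₀ (abs_nonneg _) (h n) 2
  have h2 := Finset.sum_le_card_nsmul _ _ _ h1
  simp only [Finset.card_range, nsmul_eq_mul] at h2
  refine h2.trans ?_
  rw [mul_pow]
  have : (m:ℝ) ≤ (m + 1) ^ 2 := by
    have : (0:ℝ) ≤ m := Nat.cast_nonneg m
    nlinarith
  gcongr

lemma KP_sup {z : RSeq} (hz : memL2 z) (n : ℕ) : |KP z n| ≤ 2 * l2norm z := by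
  have := aux_log (abs_le_l2 hz n)
  unfold KP
  rw [mul_assoc, abs_mul, abs_two]
  linarith

lemma lemma_M {p : RSeq × RSeq →ₗ[ℝ] RSeq} {B : ℝ} (hpm : ∀ u, memZ2 u → memL2 (p u))
    (hpm' : ∀ u, memZ2 u → memL2 (KP (p u)))
    (hpB : ∀ u, memZ2 u → l2norm (KP (p u)) + l2norm (p u) ≤ B * Z2norm u) {y : ℕ → RSeq}
    (hy : NB y) {c : ℝ} (hc : 0 < c) : ∃ k, l2norm (KP (p (y k, 0))) + l2norm (p (y k, 0)) < c := by
  by_contra hcon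
  push Not at hcon
  have hev : ∀ η > 0, ∀ᶠ k in Filter.atTop, l2norm (p (y k, 0)) < η := by
    intro η hη
    by_contra hcon
    rw [Filter.not_eventually] at hcon
    obtain ⟨φ, hφ, h1⟩ := Filter.extraction_of_frequently_atTop hcon
    obtain ⟨k, hk⟩ := lemma_K hpm (fun u hu =>
      (le_add_of_nonneg_left (l2norm_nonneg _)).trans (hpB u hu)) (hy.comp hφ) hη
    exact h1 k hk
  have hz : ∀ k, memL2 (p (y k, 0)) := fun k => hpm _ (Z2_inl (hy.fs k).memL2)
  have hKz : ∀ k, memL2 (KP (p (y k, 0))) := fun k => hpm' _ (Z2_inl (hy.fs k).memL2)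
  have step : ∀ k0 m : ℕ, ∃ q : ℕ × ℕ, k0 < q.1 ∧ m ≤ q.2 ∧
      l2norm (p (y q.1, 0)) ≤ l2norm (hd q.2 (tl m (KP (p (y q.1, 0))))) ∧
      c / 2 ≤ l2norm (hd q.2 (tl m (KP (p (y q.1, 0))))) := by
    intro k0 m
    have hm0 : (0:ℝ) < m + 1 := by positivity
    obtain ⟨k, hk1, hk2⟩ := ((Filter.eventually_gt_atTop k0).and
      (hev (c / (16 * (m + 1))) (by positivity))).exists
    set z := p (y k, 0) with hzdef
    have hzk : memL2 z := hz k
    have hKzk : memL2 (KP z) := hKz k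
    obtain ⟨m0, hm⟩ := tl_small (tl_l2 hKzk m).1 (show 0 < c / 8 by positivity)
    refine ⟨(k, max m m0), hk1, le_max_left _ _, ?_⟩
    have a1 := hm _ (le_max_right m m0)
    simp only [← hzdef]
    set X := hd (max m m0) (tl m (KP z)) with hX
    have a2 : l2norm (KP z) ≤ l2norm (hd m (KP z)) + l2norm (tl m (KP z)) := by
      have := (l2_add (hd_FS m (KP z)).memL2 (tl_l2 hKzk m).1).2
      rwa [hd_add_tl] at this
    have a3 : l2norm (tl m (KP z)) ≤ l2norm X + c / 8 := by
      have := (l2_add (hd_FS (max m m0) (tl m (KP z))).memL2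
        (tl_l2 (tl_l2 hKzk m).1 (max m m0)).1).2
      rw [hd_add_tl] at this
      linarith
    have a4 := hd_norm_le (by have := l2norm_nonneg z; positivity) (KP_sup hzk) m
    rw [lt_div_iff₀ (by positivity)] at hk2
    have a5 := hcon k
    rw [← hzdef] at a5
    have a6 : l2norm z ≤ c / 16 := by
      have : 0 ≤ l2norm z * m := mul_nonneg (l2norm_nonneg z) (Nat.cast_nonneg m)
      linarith
    have a7 : c / 2 ≤ l2norm X := by linarith
    exact ⟨by linarith, a7⟩
  choose g hg using step
  let St : ℕ → ℕ × ℕ := fun i => Nat.rec (0, 0) (fun _ q => g q.1 q.2) i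
  have hSt : ∀ i, St (i + 1) = g (St i).1 (St i).2 := fun i => rfl
  let φ : ℕ → ℕ := fun i => (St (i + 1)).1
  let M : ℕ → ℕ := fun i => (St i).2
  have hφ : StrictMono φ := strictMono_nat_of_lt_succ fun i => by
    simp only [φ]
    rw [hSt (i + 1)]
    exact (hg _ _).1
  have hM : Monotone M := monotone_nat_of_le_succ fun i => by
    simp only [M]
    rw [hSt i]
    exact (hg _ _).2.1
  let z : ℕ → RSeq := fun i => p (y (φ i), 0)
  let X : ℕ → RSeq := fun i => hd (M (i + 1)) (tl (M i) (KP (z i)))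
  have hX1 : ∀ i, l2norm (z i) ≤ l2norm (X i) := fun i => (hg (St i).1 (St i).2).2.2.1
  have hX2 : ∀ i, c / 2 ≤ l2norm (X i) := fun i => (hg (St i).1 (St i).2).2.2.2
  have hX0 : ∀ i, 0 < l2norm (X i) := fun i => lt_of_lt_of_le (by positivity) (hX2 i)
  have hXfs : ∀ i, FS (X i) := fun i => hd_FS _ _
  have hXv : ∀ i n, X i n = 0 ∨ X i n = KP (z i) n := by
    intro i n
    simp only [X, hd, tl]
    split_ifs <;> simp
  have hXhi : ∀ i n, M (i + 1) ≤ n → X i n = 0 := fun i n hn => by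
    simp [X, hd, not_lt.2 hn]
  have hXlo : ∀ i n, n < M i → X i n = 0 := fun i n hn => by
    simp [X, hd, tl, hn]
  have hdj : DJ X := by
    have key : ∀ j k n, j < k → X j n = 0 ∨ X k n = 0 := by
      intro j k n hjk
      rcases lt_or_ge n (M k) with h | h
      · exact Or.inr (hXlo k n h)
      · exact Or.inl (hXhi j n ((hM (show j + 1 ≤ k from hjk)).trans h))
    intro j k n hjk
    rcases lt_or_gt_of_ne hjk with h | h
    · exact key j k n h
    · exact (key k j n h).symm
  let x : ℕ → RSeq := fun i => (1 / l2norm (X i)) • X i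
  have hx : NB x := by
    refine ⟨fun k => (hXfs k).smul _, ?_, ?_⟩
    · intro j k n hjk
      rcases hdj j k n hjk with h | h
      · left; simp [x, h]
      · right; simp [x, h]
    · intro k
      simp only [x]
      rw [l2norm_smul, abs_of_pos (one_div_pos.2 (hX0 k))]
      have := hX0 k
      field_simp
  have hyφ := hy.comp hφ
  obtain ⟨N, hN1, hN⟩ := exists_log_gt (12 * B / (c / 8))
  have hlog := hN N le_rfl
  rw [div_lt_iff₀ (by positivity)] at hlog
  have hlog0 : 0 ≤ Real.log N := Real.log_natCast_nonneg N
  have hw : ∀ Y : RSeq, FS Y → l2norm Y = 1 → memL2 (p (KP Y, Y)) ∧ memL2 (KP (p (KP Y, Y))) ∧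
      l2norm (KP (p (KP Y, Y))) + l2norm (p (KP Y, Y)) ≤ B := by
    intro Y hY hY1
    have hm := Z2_KP hY.memL2
    refine ⟨hpm _ hm, hpm' _ hm, ?_⟩
    have := hpB _ hm
    rwa [Z2norm_KP, hY1, mul_one] at this
  have hdual : ∀ Y x : RSeq, FS Y → l2norm Y = 1 → FS x → l2norm x = 1 → ∀ J : Finset ℕ,
      |∑ n ∈ J, p (KP Y, Y) n * KP x n| ≤ 4 * B := by
    intro Y x hY hY1 hx hx1 J
    obtain ⟨w1, w2, w3⟩ := hw Y hY hY1
    refine (dual_le w1 w2 hx.memL2 hx1 J).trans ?_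
    have := l2norm_nonneg (KP (p (KP Y, Y)))
    linarith
  obtain ⟨s, hs, h⟩ := pair_signs p hyφ hN1 (fun k => KP (x k)) (Finset.range (M N))
    (c' := c / 8) (D := 4 * B)
    (fun k hk => by
      have e1 : ∑ n ∈ Finset.range (M N), z k n * KP (x k) n
          = 1 / l2norm (X k) * ∑ n ∈ Finset.range (M N), z k n * KP (X k) n := by
        rw [Finset.mul_sum]
        refine Finset.sum_congr rfl fun n _ => ?_
        simp only [x]
        rw [KP_smul, Pi.smul_apply, smul_eq_mul]
        ring
      have e2 : l2norm (X k) ^ 2 / 4 ≤ ∑ n ∈ Finset.range (M N), z k n * KP (X k) n := by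
        rw [l2norm_sq_fin (m := M N) (fun n hn => hXhi k n ((hM hk).trans hn)), Finset.sum_div]
        exact Finset.sum_le_sum fun n _ => KPKP_point (hz _) (hX1 k) (hXv k) n
      show c / 8 ≤ ∑ n ∈ Finset.range (M N), z k n * KP (x k) n
      rw [e1]
      have h3 := hX0 k
      have h4 := hX2 k
      calc c / 8 ≤ 1 / l2norm (X k) * (l2norm (X k) ^ 2 / 4) := by
            rw [show 1 / l2norm (X k) * (l2norm (X k) ^ 2 / 4) = l2norm (X k) / 4 by field_simp]
            linarith
        _ ≤ _ := mul_le_mul_of_nonneg_left e2 (by positivity))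
    (fun k hk => (le_abs_self _).trans
      (hdual _ _ (hyφ.fs k) (hyφ.nm k) (hx.fs k) (hx.nm k) _))
  set Y := comb N s (y ∘ φ) with hYdef
  have hY : FS Y := comb_FS hyφ.fs N s
  have hY1 : l2norm Y = 1 := hyφ.comb_norm hN1 hs
  set Xc := comb N s x with hXc
  have hXcf : FS Xc := comb_FS hx.fs N s
  have hXc1 : l2norm Xc = 1 := hx.comb_norm hN1 hs
  have e : comb N s (fun k => KP (x k)) = KP Xc + Real.log N • Xc := by
    rw [hXc, hx.comb_KP hN1 hs, sub_add_cancel]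
  rw [e] at h
  obtain ⟨w1, w2, w3⟩ := hw Y hY hY1
  have b1 := neg_le_of_abs_le (hdual Y Xc hY hY1 hXcf hXc1 (Finset.range (M N)))
  have b2 := flat_pair w1 w2 hXcf.memL2 hXc1 (L := Real.log N / 4) (by positivity) (fun n => by
    have := hx.comb_sup (N := N) hs n
    rw [inv_sqrt_eq_exp hN1] at this
    convert this using 3
    ring) (Finset.range (M N))
  have b3 := mul_le_mul_of_nonneg_left (neg_abs_le (∑ n ∈ Finset.range (M N), p (KP Y, Y) n * Xc n))
    hlog0
  have e4 : ∑ n ∈ Finset.range (M N), p (KP Y, Y) n * (KP Xc + Real.log N • Xc) n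
      = ∑ n ∈ Finset.range (M N), p (KP Y, Y) n * KP Xc n
        + Real.log N * ∑ n ∈ Finset.range (M N), p (KP Y, Y) n * Xc n := by
    rw [Finset.mul_sum, ← Finset.sum_add_distrib]
    refine Finset.sum_congr rfl fun n _ => ?_
    simp only [Pi.add_apply, Pi.smul_apply, smul_eq_mul]
    ring
  rw [e4] at h
  linarith

lemma exists_bound {T : RSeq × RSeq → RSeq × RSeq} (hT : BoundedOnZ2 T) :
    ∃ B, 0 ≤ B ∧ ∀ u, memZ2 u → Z2norm (T u) ≤ B * Z2norm u := by
  obtain ⟨_, B', hB'⟩ := hT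
  exact ⟨|B'|, abs_nonneg _, fun u hu => (hB' u hu).trans
      (mul_le_mul_of_nonneg_right (le_abs_self _) (Z2norm_nonneg _))⟩

/-- If any of the four maps S(ω,x) = (αω, δω), R(ω,x) = (βx, γx),
T(ω,x) = (αω + βx, 0), M(ω,x) = (0, δω + γx) is bounded on Z₂ then it is strictly
singular. -/
theorem stmt_16 (α β δ γ : RSeq →ₗ[ℝ] RSeq) :
    (BoundedOnZ2 (fun u : RSeq × RSeq => (α u.1, δ u.1)) →
      StrictlySingular (fun u : RSeq × RSeq => (α u.1, δ u.1))) ∧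
    (BoundedOnZ2 (fun u : RSeq × RSeq => (β u.2, γ u.2)) →
      StrictlySingular (fun u : RSeq × RSeq => (β u.2, γ u.2))) ∧
    (BoundedOnZ2 (fun u : RSeq × RSeq => (α u.1 + β u.2, (0 : RSeq))) →
      StrictlySingular (fun u : RSeq × RSeq => (α u.1 + β u.2, (0 : RSeq)))) ∧
    (BoundedOnZ2 (fun u : RSeq × RSeq => ((0 : RSeq), δ u.1 + γ u.2)) →
      StrictlySingular (fun u : RSeq × RSeq => ((0 : RSeq), δ u.1 + γ u.2))) := by
  refine ⟨fun hT => ?_, fun hT => ?_, fun hT => ?_, fun hT => ?_⟩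
  · obtain ⟨B, hB0, hB⟩ := exists_bound hT
    let T : LinP := (α.comp (LinearMap.fst ℝ _ _)).prod (δ.comp (LinearMap.fst ℝ _ _))
    exact ss_of_HH (T := T) hT (HH_S (T := T) hB0 hB fun y x => rfl)
  · let T : LinP := (β.comp (LinearMap.snd ℝ _ _)).prod (γ.comp (LinearMap.snd ℝ _ _))
    exact ss_of_HH (T := T) hT (HH_R (T := T) fun y => by simp [T])
  · obtain ⟨B, hB0, hB⟩ := exists_bound hT
    let p : RSeq × RSeq →ₗ[ℝ] RSeq := α.coprod β
    let T : LinP := p.prod 0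
    refine ss_of_HH (T := T) hT (HH_of_HC (T := T) hT.1 fun y hy c hc => ?_)
    have hn : ∀ u, Z2norm (T u) = l2norm (p u) := fun u => Z2norm_inl _
    obtain ⟨k, hk⟩ := lemma_K (p := p) (B := B) (fun u hu => by
      have := (hT.1 u hu).2
      have e : (p u : RSeq) - KP 0 = p u := by rw [KP_zero, sub_zero]
      rw [← e]
      exact this) (fun u hu => by rw [← hn]; exact hB u hu) hy hc
    exact ⟨k, by rw [hn]; exact hk⟩
  · obtain ⟨B, hB0, hB⟩ := exists_bound hT
    let p : RSeq × RSeq →ₗ[ℝ] RSeq := δ.coprod γ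
    let T : LinP := LinearMap.prod 0 p
    refine ss_of_HH (T := T) hT (HH_of_HC (T := T) hT.1 fun y hy c hc => ?_)
    have hn : ∀ u, Z2norm (T u) = l2norm (KP (p u)) + l2norm (p u) := fun u => by
      show l2norm (0 - KP (p u)) + l2norm (p u) = _
      rw [zero_sub, l2norm_neg]
    obtain ⟨k, hk⟩ := lemma_M (p := p) (B := B) (fun u hu => (hT.1 u hu).1) (fun u hu => by
      have h1 : memL2 (0 - KP (p u)) := (hT.1 u hu).2
      rw [zero_sub] at h1
      have := memL2_neg h1
      rwa [neg_neg] at this) (fun u hu => by rw [← hn]; exact hB u hu) hy hc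
    exact ⟨k, by rw [hn]; exact hk⟩
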